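/- arXiv:2409.08061 — 2 statements merged into one kernel-verified Lean document; each statement's English description precedes it below -/
import Mathlib

section
/- Under the standing assumptions, there exist constants c, c', C > 0 such that for every g ∈ SL(2,ℝ) and every n ≥ 0: ∫ sys(hg)^{−c} dμ^{*n}(h) ≤ C (e^{−c'n} sys(g)^{−c} + 1). -/
open MeasureTheory Filter Topology

abbrev SL2 := Matrix.SpecialLinearGroup (Fin 2) ℝ

noncomputable instance : TopologicalSpace SL2 :=
  (instTopologicalSpaceSubtype : TopologicalSpace {A : Matrix (Fin 2) (Fin 2) ℝ // A.det = 1})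

noncomputable instance : MeasurableSpace SL2 := borel SL2

/-- The group of orientation-preserving affine maps of ℝ, modeled as pairs `(r, b)`
with `r > 0`, acting by `t ↦ r * t + b`. -/
abbrev AffP : Type := {p : ℝ × ℝ // 0 < p.1}

/-- The topological support of a measure. -/
def msupport {α : Type*} [TopologicalSpace α] [MeasurableSpace α] (μ : Measure α) : Set α :=
  {x | ∀ U : Set α, IsOpen U → x ∈ U → 0 < μ U}

/-- The element of `P ⊂ SL(2,ℝ)` corresponding to the affine map `t ↦ r t + b`, namely
`a(r)⁻¹ u(b) = [[r^{-1/2}, r^{-1/2} b], [0, r^{1/2}]]`. -/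
noncomputable def toP (φ : AffP) : SL2 :=
  ⟨!![(Real.sqrt φ.1.1)⁻¹, (Real.sqrt φ.1.1)⁻¹ * φ.1.2; 0, Real.sqrt φ.1.1], by
    have h : Real.sqrt φ.1.1 ≠ 0 := ne_of_gt (Real.sqrt_pos.mpr φ.2)
    simp [Matrix.det_fin_two_of, inv_mul_cancel₀ h]⟩

/-- `convN μ n` is the `n`-fold convolution power `μ^{*n}`, i.e. the law of a product of
`n` i.i.d. `μ`-distributed matrices. -/
noncomputable def convN (μ : Measure SL2) : ℕ → Measure SL2
  | 0 => Measure.dirac 1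
  | n + 1 => Measure.map (fun p : SL2 × SL2 => p.1 * p.2) (μ.prod (convN μ n))

/-- The Euclidean norm on ℝ². -/
noncomputable def enorm2 (w : Fin 2 → ℝ) : ℝ := Real.sqrt (w 0 ^ 2 + w 1 ^ 2)

/-- The systole of `g ∈ SL(2,ℝ)`: the minimum of `‖g v‖` over nonzero `v ∈ ℤ²`. -/
noncomputable def sys (g : SL2) : ℝ :=
  sInf {x : ℝ | ∃ v : Fin 2 → ℤ, v ≠ 0 ∧
    x = enorm2 ((g : Matrix (Fin 2) (Fin 2) ℝ).mulVec (fun i => (v i : ℝ)))}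

open scoped ENNReal

namespace AffP

/-- The product dual to composition: `φ * ψ` acts as `ψ ∘ φ`, so that `toP` is multiplicative. -/
noncomputable instance : Monoid AffP where
  mul φ ψ := ⟨(φ.1.1 * ψ.1.1, ψ.1.1 * φ.1.2 + ψ.1.2), mul_pos φ.2 ψ.2⟩
  one := ⟨(1, 0), one_pos⟩
  mul_assoc φ ψ χ := by
    apply Subtype.ext
    apply Prod.ext
    · exact mul_assoc φ.1.1 ψ.1.1 χ.1.1
    · change χ.1.1 * (ψ.1.1 * φ.1.2 + ψ.1.2) + χ.1.2
        = ψ.1.1 * χ.1.1 * φ.1.2 + (χ.1.1 * ψ.1.2 + χ.1.2)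
      ring
  one_mul φ := by
    apply Subtype.ext
    apply Prod.ext
    · exact one_mul φ.1.1
    · change φ.1.1 * 0 + φ.1.2 = φ.1.2
      ring
  mul_one φ := by
    apply Subtype.ext
    apply Prod.ext
    · exact mul_one φ.1.1
    · change 1 * φ.1.2 + 0 = φ.1.2
      ring

theorem mul_fst (φ ψ : AffP) : (φ * ψ).1.1 = φ.1.1 * ψ.1.1 := rfl

theorem mul_snd (φ ψ : AffP) : (φ * ψ).1.2 = ψ.1.1 * φ.1.2 + ψ.1.2 := rfl

theorem one_fst : (1 : AffP).1.1 = 1 := rfl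

theorem one_snd : (1 : AffP).1.2 = 0 := rfl

theorem measurable_fst : Measurable fun φ : AffP => φ.1.1 := measurable_subtype_coe.fst

theorem measurable_snd : Measurable fun φ : AffP => φ.1.2 := measurable_subtype_coe.snd

instance : MeasurableMul₂ AffP where
  measurable_mul := by
    have h1 : Measurable fun p : AffP × AffP => p.1.1.1 := measurable_fst.comp _root_.measurable_fst
    have h2 : Measurable fun p : AffP × AffP => p.2.1.1 := measurable_fst.comp _root_.measurable_snd
    have h3 : Measurable fun p : AffP × AffP => p.1.1.2 := measurable_snd.comp _root_.measurable_fst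
    have h4 : Measurable fun p : AffP × AffP => p.2.1.2 := measurable_snd.comp _root_.measurable_snd
    exact ((h1.mul h2).prodMk ((h2.mul h3).add h4)).subtype_mk

end AffP

theorem toP_mul (φ ψ : AffP) : toP (φ * ψ) = toP φ * toP ψ := by
  have h1 := φ.2
  have h2 := ψ.2
  have e : Real.sqrt (φ.1.1 * ψ.1.1) = Real.sqrt φ.1.1 * Real.sqrt ψ.1.1 := Real.sqrt_mul h1.le _
  have s1 : Real.sqrt φ.1.1 ≠ 0 := (Real.sqrt_pos.mpr h1).ne'
  have s2 : Real.sqrt ψ.1.1 ≠ 0 := (Real.sqrt_pos.mpr h2).ne'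
  have q2 : Real.sqrt ψ.1.1 ^ 2 = ψ.1.1 := Real.sq_sqrt h2.le
  refine Matrix.SpecialLinearGroup.ext _ _ fun i j => ?_
  rw [Matrix.SpecialLinearGroup.coe_mul, Matrix.mul_apply, Fin.sum_univ_two]
  fin_cases i <;> fin_cases j
  · simp [toP, AffP.mul_fst, e, mul_comm]
  · simp only [toP, AffP.mul_fst, AffP.mul_snd, e]
    simp
    field_simp
    rw [q2]
    ring
  · simp [toP]
  · simp [toP, AffP.mul_fst, e]

theorem toP_one : toP 1 = 1 := by
  refine Matrix.SpecialLinearGroup.ext _ _ fun i j => ?_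
  fin_cases i <;> fin_cases j <;> simp [toP, AffP.one_fst, AffP.one_snd]

theorem toP_mulVec_zero (φ : AffP) (v : Fin 2 → ℝ) :
    (toP φ : Matrix (Fin 2) (Fin 2) ℝ).mulVec v 0
      = (Real.sqrt φ.1.1)⁻¹ * (v 0 + φ.1.2 * v 1) := by
  simp [toP, Matrix.mulVec, dotProduct, Fin.sum_univ_two]
  ring

theorem toP_mulVec_one (φ : AffP) (v : Fin 2 → ℝ) :
    (toP φ : Matrix (Fin 2) (Fin 2) ℝ).mulVec v 1 = Real.sqrt φ.1.1 * v 1 := by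
  simp [toP, Matrix.mulVec, dotProduct, Fin.sum_univ_two]

instance : BorelSpace SL2 := ⟨rfl⟩

instance : SecondCountableTopology SL2 :=
  haveI : SecondCountableTopology (Matrix (Fin 2) (Fin 2) ℝ) :=
    inferInstanceAs (SecondCountableTopology (Fin 2 → Fin 2 → ℝ))
  TopologicalSpace.Subtype.secondCountableTopology _

theorem continuous_coe_SL2 : Continuous fun h : SL2 => (h : Matrix (Fin 2) (Fin 2) ℝ) :=
  continuous_induced_dom

instance : ContinuousMul SL2 where
  continuous_mul := by
    refine continuous_induced_rng.2 ?_
    exact (continuous_coe_SL2.comp continuous_fst).matrix_mul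
      (continuous_coe_SL2.comp continuous_snd)

theorem measurable_toP : Measurable toP := by
  have h : Continuous toP := by
    refine continuous_induced_rng.2 ?_
    refine continuous_matrix fun i j => ?_
    have c1 : Continuous fun φ : AffP => Real.sqrt φ.1.1 := by fun_prop
    have c2 : Continuous fun φ : AffP => (Real.sqrt φ.1.1)⁻¹ :=
      c1.inv₀ fun φ => (Real.sqrt_pos.mpr φ.2).ne'
    have c3 : Continuous fun φ : AffP => φ.1.2 := by fun_prop
    fin_cases i <;> fin_cases j
    · exact c2
    · exact c2.mul c3
    · exact continuous_const
    · exact c1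
  exact h.measurable

/-- Convolution powers of a law on the affine group. -/
noncomputable def affConv (lam : Measure AffP) : ℕ → Measure AffP
  | 0 => Measure.dirac 1
  | n + 1 => lam.mconv (affConv lam n)

instance (lam : Measure AffP) [IsProbabilityMeasure lam] (n : ℕ) :
    IsProbabilityMeasure (affConv lam n) := by
  induction n with
  | zero => exact Measure.dirac.isProbabilityMeasure
  | succ n ih => exact Measure.probabilitymeasure_of_probabilitymeasures_mconv _ _

theorem convN_map_toP (lam : Measure AffP) [IsProbabilityMeasure lam] (n : ℕ) :
    convN (Measure.map toP lam) n = Measure.map toP (affConv lam n) := by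
  induction n with
  | zero => rw [convN, affConv, Measure.map_dirac' measurable_toP, toP_one]
  | succ n ih =>
    rw [convN, ih, affConv, Measure.mconv, Measure.map_prod_map _ _ measurable_toP measurable_toP,
      Measure.map_map (by fun_prop) (measurable_toP.prodMap measurable_toP),
      Measure.map_map measurable_toP (by fun_prop)]
    congr 1
    ext p : 1
    simp [toP_mul]

theorem affConv_add (lam : Measure AffP) [IsProbabilityMeasure lam] (m n : ℕ) :
    affConv lam (m + n) = (affConv lam m).mconv (affConv lam n) := by
  induction m with
  | zero => simp [affConv]
  | succ m ih => rw [Nat.succ_add, affConv, affConv, ih, Measure.mconv_assoc]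

theorem affConv_one (lam : Measure AffP) [IsProbabilityMeasure lam] : affConv lam 1 = lam := by
  simp [affConv]

theorem lintegral_mconv_le_swap (μ ν : Measure AffP) [SFinite μ] [SFinite ν] (f : AffP → ℝ≥0∞) :
    ∫⁻ z, f z ∂(μ.mconv ν) ≤ ∫⁻ y, ∫⁻ x, f (x * y) ∂μ ∂ν := by
  refine (lintegral_map_le _ _).trans ?_
  rw [← Measure.prod_swap]
  exact (lintegral_map_le _ _).trans (lintegral_prod_le _)

theorem det_eq_one_SL2 (h : SL2) : h.1 0 0 * h.1 1 1 - h.1 0 1 * h.1 1 0 = 1 := by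
  rw [← Matrix.det_fin_two]
  exact h.2

theorem mulVec_fin_two (A : Matrix (Fin 2) (Fin 2) ℝ) (v : Fin 2 → ℝ) (i : Fin 2) :
    A.mulVec v i = A i 0 * v 0 + A i 1 * v 1 := by
  simp [Matrix.mulVec, dotProduct, Fin.sum_univ_two]

/-- The Frobenius norm of an element of `SL(2,ℝ)`. -/
noncomputable def frob (h : SL2) : ℝ :=
  Real.sqrt (h.1 0 0 ^ 2 + h.1 0 1 ^ 2 + h.1 1 0 ^ 2 + h.1 1 1 ^ 2)

theorem one_le_frob (h : SL2) : 1 ≤ frob h := by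
  rw [frob, Real.one_le_sqrt]
  nlinarith [det_eq_one_SL2 h, sq_nonneg (h.1 0 0 - h.1 1 1), sq_nonneg (h.1 0 1 + h.1 1 0)]

theorem frob_pos (h : SL2) : 0 < frob h := one_pos.trans_le (one_le_frob h)

theorem frob_mul_le (h k : SL2) : frob (h * k) ≤ frob h * frob k := by
  rw [frob, frob, frob, ← Real.sqrt_mul (by positivity)]
  apply Real.sqrt_le_sqrt
  have e : ∀ i j, (h * k).1 i j = h.1 i 0 * k.1 0 j + h.1 i 1 * k.1 1 j := by
    intro i j
    have : (h * k).1 = h.1 * k.1 := rfl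
    rw [this, Matrix.mul_apply, Fin.sum_univ_two]
  simp only [e]
  nlinarith [sq_nonneg (h.1 0 0 * k.1 1 0 - h.1 0 1 * k.1 0 0),
    sq_nonneg (h.1 0 0 * k.1 1 1 - h.1 0 1 * k.1 0 1),
    sq_nonneg (h.1 1 0 * k.1 1 0 - h.1 1 1 * k.1 0 0),
    sq_nonneg (h.1 1 0 * k.1 1 1 - h.1 1 1 * k.1 0 1)]

theorem enorm2_nonneg (v : Fin 2 → ℝ) : 0 ≤ enorm2 v := Real.sqrt_nonneg _

theorem enorm2_smul (t : ℝ) (v : Fin 2 → ℝ) : enorm2 (t • v) = |t| * enorm2 v := by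
  rw [enorm2, enorm2, ← Real.sqrt_sq_eq_abs, ← Real.sqrt_mul (sq_nonneg t)]
  congr 1
  simp only [Pi.smul_apply, smul_eq_mul]
  ring

theorem enorm2_pos {v : Fin 2 → ℝ} (hv : v ≠ 0) : 0 < enorm2 v := by
  refine Real.sqrt_pos.mpr ?_
  by_contra! h
  apply hv
  ext i
  fin_cases i
  · have : v 0 ^ 2 = 0 := by nlinarith [sq_nonneg (v 0), sq_nonneg (v 1)]
    exact (pow_eq_zero_iff two_ne_zero).1 this
  · have : v 1 ^ 2 = 0 := by nlinarith [sq_nonneg (v 0), sq_nonneg (v 1)]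
    exact (pow_eq_zero_iff two_ne_zero).1 this

theorem abs_apply_le_enorm2 (v : Fin 2 → ℝ) (i : Fin 2) : |v i| ≤ enorm2 v := by
  refine Real.abs_le_sqrt ?_
  fin_cases i
  · simpa using sq_nonneg (v 1)
  · simpa using sq_nonneg (v 0)

theorem abs_det_le_enorm2_mul (v w : Fin 2 → ℝ) :
    |v 0 * w 1 - v 1 * w 0| ≤ enorm2 v * enorm2 w := by
  rw [enorm2, enorm2, ← Real.sqrt_mul (by positivity)]
  refine Real.abs_le_sqrt ?_
  nlinarith [sq_nonneg (v 0 * w 0 + v 1 * w 1)]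

theorem enorm2_mulVec_le (h : SL2) (v : Fin 2 → ℝ) :
    enorm2 (h.1.mulVec v) ≤ frob h * enorm2 v := by
  rw [enorm2, enorm2, frob, ← Real.sqrt_mul (by positivity)]
  apply Real.sqrt_le_sqrt
  simp only [mulVec_fin_two]
  nlinarith [sq_nonneg (h.1 0 0 * v 1 - h.1 0 1 * v 0), sq_nonneg (h.1 1 0 * v 1 - h.1 1 1 * v 0)]

theorem enorm2_le_frob_mul (h : SL2) (v : Fin 2 → ℝ) :
    enorm2 v ≤ frob h * enorm2 (h.1.mulVec v) := by
  have d := det_eq_one_SL2 h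
  have e0 : v 0 = h.1 1 1 * h.1.mulVec v 0 - h.1 0 1 * h.1.mulVec v 1 := by
    simp only [mulVec_fin_two]
    linear_combination (-v 0) * d
  have e1 : v 1 = -h.1 1 0 * h.1.mulVec v 0 + h.1 0 0 * h.1.mulVec v 1 := by
    simp only [mulVec_fin_two]
    linear_combination (-v 1) * d
  rw [enorm2, enorm2, frob, ← Real.sqrt_mul (by positivity)]
  apply Real.sqrt_le_sqrt
  rw [e0, e1]
  nlinarith [sq_nonneg (h.1 1 1 * h.1.mulVec v 1 + h.1 0 1 * h.1.mulVec v 0),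
    sq_nonneg (h.1 1 0 * h.1.mulVec v 1 + h.1 0 0 * h.1.mulVec v 0)]

/-- The real vector underlying an integer vector. -/
def intVec (v : Fin 2 → ℤ) : Fin 2 → ℝ := fun i => (v i : ℝ)

theorem intVec_ne_zero {v : Fin 2 → ℤ} (hv : v ≠ 0) : intVec v ≠ 0 := by
  intro h
  apply hv
  ext i
  simpa [intVec] using congrFun h i

theorem finite_enorm2_mulVec_le (g : SL2) (R : ℝ) :
    {v : Fin 2 → ℤ | enorm2 (g.1.mulVec (intVec v)) ≤ R}.Finite := by
  refine (Set.finite_Icc (fun _ => -⌈frob g * R⌉) (fun _ => ⌈frob g * R⌉)).subset ?_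
  intro v hv
  have h1 : ∀ i, |(v i : ℝ)| ≤ ⌈frob g * R⌉ := fun i =>
    ((abs_apply_le_enorm2 (intVec v) i).trans (enorm2_le_frob_mul g _)).trans
      ((mul_le_mul_of_nonneg_left hv (frob_pos g).le).trans (Int.le_ceil _))
  refine ⟨fun i => ?_, fun i => ?_⟩
  · have := (abs_le.1 (h1 i)).1
    exact_mod_cast this
  · have := (abs_le.1 (h1 i)).2
    exact_mod_cast this

/-- The systole is attained. -/
theorem exists_isLeast_sys (g : SL2) :
    ∃ v : Fin 2 → ℤ, v ≠ 0 ∧ sys g = enorm2 (g.1.mulVec (intVec v)) ∧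
      ∀ w : Fin 2 → ℤ, w ≠ 0 → sys g ≤ enorm2 (g.1.mulVec (intVec w)) := by
  let N : (Fin 2 → ℤ) → ℝ := fun v => enorm2 (g.1.mulVec (intVec v))
  have h1 : (1 : Fin 2 → ℤ) ≠ 0 := one_ne_zero
  obtain ⟨v, ⟨hvR, hv0⟩, hmin⟩ := Set.exists_min_image ({v | N v ≤ N 1} ∩ {v | v ≠ 0}) N
    ((finite_enorm2_mulVec_le g (N 1)).inter_of_left _) ⟨1, le_refl (N 1), h1⟩
  have hle : ∀ w : Fin 2 → ℤ, w ≠ 0 → N v ≤ N w := by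
    intro w hw
    rcases le_total (N w) (N 1) with h | h
    · exact hmin w ⟨h, hw⟩
    · exact le_trans hvR h
  have hL : IsLeast {x : ℝ | ∃ v : Fin 2 → ℤ, v ≠ 0 ∧
      x = enorm2 ((g : Matrix (Fin 2) (Fin 2) ℝ).mulVec (fun i => (v i : ℝ)))} (N v) := by
    refine ⟨⟨v, hv0, rfl⟩, ?_⟩
    rintro x ⟨w, hw, rfl⟩
    exact hle w hw
  have hs : sys g = N v := hL.csInf_eq
  exact ⟨v, hv0, hs, fun w hw => hs ▸ hle w hw⟩

theorem mulVec_ne_zero_SL2 (g : SL2) {v : Fin 2 → ℝ} (hv : v ≠ 0) : g.1.mulVec v ≠ 0 := by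
  intro h
  have h1 := enorm2_le_frob_mul g v
  have h2 := enorm2_pos hv
  have h3 : enorm2 0 = 0 := by simp [enorm2]
  rw [h, h3, mul_zero] at h1
  exact h2.not_ge h1

theorem sys_pos (g : SL2) : 0 < sys g := by
  obtain ⟨v, hv, hs, -⟩ := exists_isLeast_sys g
  rw [hs]
  exact enorm2_pos (mulVec_ne_zero_SL2 g (intVec_ne_zero hv))

theorem coe_mul_mulVec (h g : SL2) (v : Fin 2 → ℝ) :
    (h * g).1.mulVec v = h.1.mulVec (g.1.mulVec v) :=
  (Matrix.mulVec_mulVec v h.1 g.1).symm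

theorem sys_le_frob_mul_sys (h g : SL2) : sys g ≤ frob h * sys (h * g) := by
  obtain ⟨v, hv, hs, -⟩ := exists_isLeast_sys (h * g)
  obtain ⟨-, -, -, hle⟩ := exists_isLeast_sys g
  rw [hs, coe_mul_mulVec]
  exact (hle v hv).trans (enorm2_le_frob_mul h _)

/-- If `u` is a shortest vector of the lattice `gℤ²`, then the systole of `hgℤ²` is controlled from
below by `hu`, up to a bound depending on `h` only. -/
theorem exists_min_le_sys_mul (g : SL2) :
    ∃ u : Fin 2 → ℝ, u ≠ 0 ∧ enorm2 u = sys g ∧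
      ∀ h : SL2, min (enorm2 (h.1.mulVec u)) (frob h)⁻¹ ≤ sys (h * g) := by
  obtain ⟨v, hv, hs, hle⟩ := exists_isLeast_sys g
  have hspos := sys_pos g
  refine ⟨g.1.mulVec (intVec v), mulVec_ne_zero_SL2 g (intVec_ne_zero hv), hs.symm, fun h => ?_⟩
  obtain ⟨w, hw, hsw, -⟩ := exists_isLeast_sys (h * g)
  rw [hsw, coe_mul_mulVec]
  have hgw := hle w hw
  by_cases hdet : v 0 * w 1 - v 1 * w 0 = 0
  · refine (min_le_left _ _).trans ?_
    obtain ⟨t, ht⟩ : ∃ t : ℝ, intVec w = t • intVec v := by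
      have hdet' : (v 0 : ℝ) * w 1 - v 1 * w 0 = 0 := by exact_mod_cast hdet
      by_cases h0 : v 0 = 0
      · have h1 : v 1 ≠ 0 := by
          intro h1
          apply hv
          ext i
          fin_cases i
          · exact h0
          · exact h1
        have h1' : (v 1 : ℝ) ≠ 0 := by exact_mod_cast h1
        have h0' : (v 0 : ℝ) = 0 := by exact_mod_cast h0
        refine ⟨w 1 / v 1, ?_⟩
        ext i
        fin_cases i
        · simp only [intVec, Pi.smul_apply, smul_eq_mul, Fin.zero_eta]
          rw [h0', mul_zero]
          rw [h0', zero_mul, zero_sub, neg_eq_zero, mul_eq_zero] at hdet'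
          exact hdet'.resolve_left h1'
        · simp [intVec, h1']
      · have h0' : (v 0 : ℝ) ≠ 0 := by exact_mod_cast h0
        refine ⟨w 0 / v 0, ?_⟩
        ext i
        fin_cases i
        · simp [intVec, h0']
        · simp only [intVec, Pi.smul_apply, smul_eq_mul, Fin.mk_one]
          field_simp
          linarith
    rw [ht, Matrix.mulVec_smul, enorm2_smul, ← hs] at hgw
    rw [ht, Matrix.mulVec_smul, Matrix.mulVec_smul, enorm2_smul]
    have ht1 : 1 ≤ |t| := by
      by_contra! hlt
      nlinarith
    exact le_mul_of_one_le_left (enorm2_nonneg _) ht1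
  · refine (min_le_right _ _).trans ?_
    have hdet1 : (1 : ℝ) ≤ |(v 0 : ℝ) * w 1 - v 1 * w 0| := by
      exact_mod_cast Int.one_le_abs hdet
    have hd := abs_det_le_enorm2_mul (g.1.mulVec (intVec v)) (g.1.mulVec (intVec w))
    have e : g.1.mulVec (intVec v) 0 * g.1.mulVec (intVec w) 1
        - g.1.mulVec (intVec v) 1 * g.1.mulVec (intVec w) 0
        = (v 0 : ℝ) * w 1 - v 1 * w 0 := by
      simp only [mulVec_fin_two, intVec]
      linear_combination ((v 0 : ℝ) * w 1 - v 1 * w 0) * det_eq_one_SL2 g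
    rw [e, ← hs] at hd
    have h1 : 1 ≤ enorm2 (g.1.mulVec (intVec w)) := by
      by_contra! hlt
      nlinarith
    rw [inv_le_iff_one_le_mul₀ (frob_pos h), mul_comm]
    exact h1.trans (enorm2_le_frob_mul h _)

theorem exp_mul_le_quadratic {c δ : ℝ} (hδ : 0 < δ) (hc : 0 ≤ c) (hcδ : c ≤ δ) (y : ℝ) :
    Real.exp (c * y) ≤ 1 + c * y + c ^ 2 * (2 / δ ^ 2 * Real.exp (2 * δ * |y|)) := by
  have h1 := Complex.norm_exp_sub_sum_le_norm_mul_exp ((c * y : ℝ) : ℂ) 2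
  have e : Complex.exp ((c * y : ℝ) : ℂ)
      - ∑ m ∈ Finset.range 2, ((c * y : ℝ) : ℂ) ^ m / (m.factorial : ℂ)
      = ((Real.exp (c * y) - (1 + c * y) : ℝ) : ℂ) := by
    simp [Finset.sum_range_succ]
  rw [e, Complex.norm_real, Complex.norm_real, Real.norm_eq_abs, Real.norm_eq_abs, abs_mul,
    abs_of_nonneg hc] at h1
  have h2 := (le_abs_self _).trans h1
  have h3 : Real.exp (c * |y|) ≤ Real.exp (δ * |y|) :=
    Real.exp_le_exp.mpr (mul_le_mul_of_nonneg_right hcδ (abs_nonneg y))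
  have h4 : (δ * |y|) ^ 2 / 2 ≤ Real.exp (δ * |y|) := by
    have := Real.quadratic_le_exp_of_nonneg (mul_nonneg hδ.le (abs_nonneg y))
    linarith [mul_nonneg hδ.le (abs_nonneg y)]
  have h5 : y ^ 2 ≤ 2 / δ ^ 2 * Real.exp (δ * |y|) := by
    rw [div_mul_eq_mul_div, le_div_iff₀ (by positivity)]
    rw [mul_pow, sq_abs] at h4
    linarith
  have h6 : Real.exp (2 * δ * |y|) = Real.exp (δ * |y|) * Real.exp (δ * |y|) := by
    rw [← Real.exp_add]
    ring_nf
  have h7 : (c * |y|) ^ 2 * Real.exp (c * |y|)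
      ≤ c ^ 2 * (2 / δ ^ 2 * Real.exp (2 * δ * |y|)) := by
    rw [h6, mul_pow, sq_abs, mul_assoc, ← mul_assoc (2 / δ ^ 2)]
    refine mul_le_mul_of_nonneg_left ?_ (sq_nonneg c)
    exact mul_le_mul h5 h3 (Real.exp_pos _).le (by positivity)
  linarith

theorem integrable_of_lintegral_ofReal_le {Ω : Type*} [MeasurableSpace Ω] {μ : Measure Ω}
    {f : Ω → ℝ} (hf : Measurable f) (hf0 : ∀ ω, 0 ≤ f ω) {A : ℝ}
    (hA : ∫⁻ ω, ENNReal.ofReal (f ω) ∂μ ≤ ENNReal.ofReal A) : Integrable f μ := by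
  refine ⟨hf.aestronglyMeasurable, ?_⟩
  rw [hasFiniteIntegral_iff_ofReal (ae_of_all _ hf0)]
  exact hA.trans_lt ENNReal.ofReal_lt_top

theorem integral_le_of_lintegral_ofReal_le {Ω : Type*} [MeasurableSpace Ω] {μ : Measure Ω}
    {f : Ω → ℝ} (hf : Measurable f) (hf0 : ∀ ω, 0 ≤ f ω) {A : ℝ} (hA0 : 0 ≤ A)
    (hA : ∫⁻ ω, ENNReal.ofReal (f ω) ∂μ ≤ ENNReal.ofReal A) : ∫ ω, f ω ∂μ ≤ A := by
  rw [integral_eq_lintegral_of_nonneg_ae (ae_of_all _ hf0) hf.aestronglyMeasurable]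
  exact ENNReal.toReal_le_of_le_ofReal hA0 hA

theorem lintegral_exp_mul_le {Ω : Type*} [MeasurableSpace Ω] (μ : Measure Ω)
    [IsProbabilityMeasure μ] {Y : Ω → ℝ} (hY : Measurable Y) {δ B d : ℝ} (hδ : 0 < δ)
    (hB0 : 0 ≤ B)
    (hB : ∫⁻ ω, ENNReal.ofReal (Real.exp (2 * δ * |Y ω|)) ∂μ ≤ ENNReal.ofReal B)
    (hd : ∫ ω, Y ω ∂μ ≤ -d) {c : ℝ} (hc : 0 ≤ c) (hcδ : c ≤ δ) :
    ∫⁻ ω, ENNReal.ofReal (Real.exp (c * Y ω)) ∂μ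
      ≤ ENNReal.ofReal (1 - c * d + c ^ 2 * (2 / δ ^ 2 * B)) := by
  have mE : Measurable fun ω => Real.exp (2 * δ * |Y ω|) :=
    Real.measurable_exp.comp ((hY.norm).const_mul _)
  have iE : Integrable (fun ω => Real.exp (2 * δ * |Y ω|)) μ :=
    integrable_of_lintegral_ofReal_le mE (fun _ => (Real.exp_pos _).le) hB
  have iY : Integrable Y μ := by
    refine (iE.const_mul (1 / (2 * δ))).mono' hY.aestronglyMeasurable (ae_of_all _ fun ω => ?_)
    rw [Real.norm_eq_abs, div_mul_eq_mul_div, one_mul, le_div_iff₀ (by positivity)]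
    linarith [Real.add_one_le_exp (2 * δ * |Y ω|)]
  have hEB : ∫ ω, Real.exp (2 * δ * |Y ω|) ∂μ ≤ B :=
    integral_le_of_lintegral_ofReal_le mE (fun _ => (Real.exp_pos _).le) hB0 hB
  have iU : Integrable (fun ω => 1 + c * Y ω + c ^ 2 * (2 / δ ^ 2 * Real.exp (2 * δ * |Y ω|))) μ :=
    ((integrable_const 1).add (iY.const_mul c)).add ((iE.const_mul _).const_mul _)
  calc ∫⁻ ω, ENNReal.ofReal (Real.exp (c * Y ω)) ∂μ
      ≤ ∫⁻ ω, ENNReal.ofReal (1 + c * Y ω + c ^ 2 * (2 / δ ^ 2 * Real.exp (2 * δ * |Y ω|))) ∂μ :=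
        lintegral_mono fun ω => ENNReal.ofReal_le_ofReal (exp_mul_le_quadratic hδ hc hcδ _)
    _ = ENNReal.ofReal (∫ ω, 1 + c * Y ω + c ^ 2 * (2 / δ ^ 2 * Real.exp (2 * δ * |Y ω|)) ∂μ) := by
        rw [ofReal_integral_eq_lintegral_ofReal iU]
        exact ae_of_all _ fun ω => (Real.exp_pos _).le.trans (exp_mul_le_quadratic hδ hc hcδ _)
    _ ≤ _ := by
        apply ENNReal.ofReal_le_ofReal
        have i1 : Integrable (fun ω => 1 + c * Y ω) μ :=
          (integrable_const 1).add (iY.const_mul c)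
        rw [integral_add i1 ((iE.const_mul _).const_mul _),
          integral_add (integrable_const 1) (iY.const_mul c), integral_const_mul, integral_const_mul,
          integral_const_mul]
        simp only [integral_const, probReal_univ, smul_eq_mul, one_mul]
        have h1 := mul_le_mul_of_nonneg_left hd hc
        have h2 : c ^ 2 * (2 / δ ^ 2 * ∫ ω, Real.exp (2 * δ * |Y ω|) ∂μ)
            ≤ c ^ 2 * (2 / δ ^ 2 * B) := by gcongr
        linarith

theorem exists_quadratic_lt_one {δ d K : ℝ} (hδ : 0 < δ) (hd : 0 < d) (hK : 0 ≤ K) :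
    ∃ c ρ : ℝ, 0 < c ∧ c ≤ δ ∧ 0 < ρ ∧ ρ < 1 ∧ 1 - c * d + c ^ 2 * K ≤ ρ := by
  refine ⟨min δ (min (1 / d) (d / (2 * (K + 1)))),
    1 - min δ (min (1 / d) (d / (2 * (K + 1)))) * d / 2, ?_⟩
  set c := min δ (min (1 / d) (d / (2 * (K + 1)))) with hc
  have hc0 : 0 < c := by positivity
  have h1 : c ≤ 1 / d := (min_le_right _ _).trans (min_le_left _ _)
  have h2 : c ≤ d / (2 * (K + 1)) := (min_le_right _ _).trans (min_le_right _ _)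
  rw [le_div_iff₀ hd] at h1
  rw [le_div_iff₀ (by positivity)] at h2
  refine ⟨hc0, min_le_left _ _, by linarith, by nlinarith, ?_⟩
  nlinarith

theorem lintegral_affConv_le_pow {lam : Measure AffP} [IsProbabilityMeasure lam] {f : AffP → ℝ}
    (hf : Measurable f) (hf0 : ∀ φ, 0 ≤ f φ) (hmul : ∀ φ ψ, f (φ * ψ) ≤ f φ * f ψ) {A : ℝ}
    (hA0 : 0 ≤ A) (hA : ∫⁻ φ, ENNReal.ofReal (f φ) ∂lam ≤ ENNReal.ofReal A) (n : ℕ) :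
    ∫⁻ φ, ENNReal.ofReal (f φ) ∂(affConv lam n) ≤ ENNReal.ofReal (A ^ n * f 1) := by
  induction n with
  | zero => simp [affConv, lintegral_dirac' _ hf.ennreal_ofReal]
  | succ n ih =>
    rw [affConv, Measure.lintegral_mconv hf.ennreal_ofReal]
    calc ∫⁻ x, ∫⁻ y, ENNReal.ofReal (f (x * y)) ∂(affConv lam n) ∂lam
        ≤ ∫⁻ x, ∫⁻ y, ENNReal.ofReal (f x) * ENNReal.ofReal (f y) ∂(affConv lam n) ∂lam := by
          refine lintegral_mono fun x => lintegral_mono fun y => ?_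
          rw [← ENNReal.ofReal_mul (hf0 x)]
          exact ENNReal.ofReal_le_ofReal (hmul x y)
      _ = (∫⁻ x, ENNReal.ofReal (f x) ∂lam) * ∫⁻ y, ENNReal.ofReal (f y) ∂(affConv lam n) := by
          simp_rw [lintegral_const_mul _ hf.ennreal_ofReal]
          rw [lintegral_mul_const _ hf.ennreal_ofReal]
      _ ≤ ENNReal.ofReal A * ENNReal.ofReal (A ^ n * f 1) := mul_le_mul' hA ih
      _ = _ := by
          rw [← ENNReal.ofReal_mul hA0, pow_succ]
          ring_nf

theorem sq_frob_toP (φ : AffP) :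
    frob (toP φ) ^ 2 = φ.1.1⁻¹ + φ.1.1⁻¹ * φ.1.2 ^ 2 + φ.1.1 := by
  have h := Real.sq_sqrt φ.2.le
  rw [frob, Real.sq_sqrt (by positivity)]
  simp only [toP, Matrix.of_apply, Matrix.cons_val', Matrix.cons_val_zero, Matrix.cons_val_one,
    Matrix.cons_val_fin_one]
  rw [mul_pow, inv_pow, h]
  ring

theorem measurable_frob_toP : Measurable fun φ : AffP => frob (toP φ) := by
  have h : (fun φ : AffP => frob (toP φ))
      = fun φ => Real.sqrt (φ.1.1⁻¹ + φ.1.1⁻¹ * φ.1.2 ^ 2 + φ.1.1) := by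
    ext φ
    rw [← sq_frob_toP, Real.sqrt_sq (frob_pos _).le]
  rw [h]
  have h1 := AffP.measurable_fst
  have h2 := AffP.measurable_snd
  fun_prop

theorem fst_le_sq_frob (φ : AffP) : φ.1.1 ≤ frob (toP φ) ^ 2 := by
  rw [sq_frob_toP]
  have := inv_pos.2 φ.2
  nlinarith [mul_nonneg this.le (sq_nonneg φ.1.2)]

theorem inv_fst_le_sq_frob (φ : AffP) : φ.1.1⁻¹ ≤ frob (toP φ) ^ 2 := by
  rw [sq_frob_toP]
  have := inv_pos.2 φ.2
  nlinarith [mul_nonneg this.le (sq_nonneg φ.1.2), φ.2]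

theorem abs_snd_le_sq_frob (φ : AffP) : |φ.1.2| ≤ frob (toP φ) ^ 2 := by
  rw [sq_frob_toP]
  have h := inv_pos.2 φ.2
  have h1 : φ.1.1⁻¹ * φ.1.1 = 1 := inv_mul_cancel₀ φ.2.ne'
  have h2 : φ.1.1⁻¹ * (|φ.1.2| - φ.1.1) ^ 2 = φ.1.1⁻¹ * φ.1.2 ^ 2 - 2 * |φ.1.2| + φ.1.1 := by
    have : (|φ.1.2| - φ.1.1) ^ 2 = φ.1.2 ^ 2 - 2 * |φ.1.2| * φ.1.1 + φ.1.1 ^ 2 := by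
      rw [← sq_abs φ.1.2]
      ring
    rw [this]
    linear_combination (-2 * |φ.1.2| + φ.1.1) * h1
  have h3 := mul_nonneg h.le (sq_nonneg (|φ.1.2| - φ.1.1))
  linarith [abs_nonneg φ.1.2]

theorem log_frob_nonneg (h : SL2) : 0 ≤ Real.log (frob h) := Real.log_nonneg (one_le_frob h)

theorem abs_log_fst_le (φ : AffP) : |Real.log φ.1.1| ≤ 2 * Real.log (frob (toP φ)) := by
  have e : 2 * Real.log (frob (toP φ)) = Real.log (frob (toP φ) ^ 2) := by
    rw [Real.log_pow]
    norm_num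
  rw [e, abs_le]
  constructor
  · rw [neg_le, ← Real.log_inv]
    exact Real.log_le_log (inv_pos.2 φ.2) (inv_fst_le_sq_frob φ)
  · exact Real.log_le_log φ.2 (fst_le_sq_frob φ)

/-- The exponential moment hypothesis, in terms of the Frobenius norm. -/
theorem exists_moment_frob {lam : Measure AffP}
    (hmom : ∃ ε : ℝ, 0 < ε ∧
      ∫⁻ φ : AffP, ENNReal.ofReal (φ.1.1 ^ ε + φ.1.1 ^ (-ε) + |φ.1.2| ^ ε) ∂lam < ⊤) :
    ∃ θ M : ℝ, 0 < θ ∧ 1 ≤ M ∧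
      ∫⁻ φ, ENNReal.ofReal (frob (toP φ) ^ θ) ∂lam ≤ ENNReal.ofReal M := by
  obtain ⟨ε, hε, hfin⟩ := hmom
  have hpt : ∀ φ : AffP, frob (toP φ) ^ (2 * ε / 3)
      ≤ 3 ^ (ε / 3) * (φ.1.1 ^ ε + φ.1.1 ^ (-ε) + |φ.1.2| ^ ε) := by
    intro φ
    set T := max φ.1.1 (max φ.1.1⁻¹ |φ.1.2|) with hT
    have t1 : φ.1.1 ≤ T := le_max_left _ _
    have t2 : φ.1.1⁻¹ ≤ T := (le_max_left _ _).trans (le_max_right _ _)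
    have t3 : |φ.1.2| ≤ T := (le_max_right _ _).trans (le_max_right _ _)
    have hi := inv_pos.2 φ.2
    have hr := φ.2
    have hT0 : 0 < T := hr.trans_le t1
    have hT1 : 1 ≤ T := by
      have : φ.1.1⁻¹ * φ.1.1 = 1 := inv_mul_cancel₀ φ.2.ne'
      by_contra! hlt
      nlinarith
    have hW : frob (toP φ) ^ 2 ≤ 3 * T ^ 3 := by
      rw [sq_frob_toP, ← sq_abs φ.1.2]
      have h1 : φ.1.1⁻¹ * |φ.1.2| ^ 2 ≤ T * T ^ 2 := by gcongr
      nlinarith [mul_nonneg (sub_nonneg.2 hT1) hT0.le, mul_nonneg (sub_nonneg.2 hT1) (sq_nonneg T)]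
    have e1 : frob (toP φ) ^ (2 * ε / 3) = (frob (toP φ) ^ 2) ^ (ε / 3) := by
      rw [← Real.rpow_natCast, ← Real.rpow_mul (frob_pos _).le]
      congr 1
      push_cast
      ring
    have e2 : (3 * T ^ 3) ^ (ε / 3) = 3 ^ (ε / 3) * T ^ ε := by
      rw [Real.mul_rpow (by norm_num) (by positivity), ← Real.rpow_natCast,
        ← Real.rpow_mul hT0.le]
      congr 2
      push_cast
      ring
    rw [e1]
    refine (Real.rpow_le_rpow (by positivity) hW (by positivity)).trans ?_
    rw [e2]
    refine mul_le_mul_of_nonneg_left ?_ (by positivity)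
    have p1 : 0 ≤ φ.1.1 ^ ε := by positivity
    have p2 : 0 ≤ φ.1.1 ^ (-ε) := by positivity
    have p3 : 0 ≤ |φ.1.2| ^ ε := by positivity
    rw [Real.rpow_neg hr.le, ← Real.inv_rpow hr.le] at *
    rcases max_choice φ.1.1 (max φ.1.1⁻¹ |φ.1.2|) with h | h
    · rw [hT, h]
      linarith
    · rcases max_choice φ.1.1⁻¹ |φ.1.2| with h' | h'
      · rw [hT, h, h']
        linarith
      · rw [hT, h, h']
        linarith
  set I := ∫⁻ φ, ENNReal.ofReal (frob (toP φ) ^ (2 * ε / 3)) ∂lam with hI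
  have hIfin : I ≠ ⊤ := by
    refine ne_of_lt (lt_of_le_of_lt (lintegral_mono fun φ => ENNReal.ofReal_le_ofReal (hpt φ)) ?_)
    simp_rw [ENNReal.ofReal_mul (show (0 : ℝ) ≤ 3 ^ (ε / 3) by positivity)]
    rw [lintegral_const_mul' _ _ ENNReal.ofReal_ne_top]
    exact ENNReal.mul_lt_top ENNReal.ofReal_lt_top hfin
  refine ⟨2 * ε / 3, max 1 I.toReal, by positivity, le_max_left _ _, ?_⟩
  rw [← hI]
  exact (ENNReal.ofReal_toReal hIfin).symm.le.trans (ENNReal.ofReal_le_ofReal (le_max_right _ _))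

/-- Negativity of the Lyapunov exponent gives contraction in some `L^α`. -/
theorem exists_contraction_exponent {lam : Measure AffP} [IsProbabilityMeasure lam] {θ M : ℝ}
    (hθ : 0 < θ) (hM : 1 ≤ M)
    (hmom : ∫⁻ φ, ENNReal.ofReal (frob (toP φ) ^ θ) ∂lam ≤ ENNReal.ofReal M)
    (hcontr : ∫ φ : AffP, Real.log φ.1.1 ∂lam < 0) :
    ∃ α ρ : ℝ, 0 < α ∧ α ≤ 1 ∧ 2 * α ≤ θ ∧ 0 < ρ ∧ ρ < 1 ∧
      ∫⁻ φ : AffP, ENNReal.ofReal (φ.1.1 ^ α) ∂lam ≤ ENNReal.ofReal ρ := by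
  have hδ : 0 < min (θ / 4) 1 := by positivity
  have hB : ∫⁻ φ : AffP, ENNReal.ofReal (Real.exp (2 * min (θ / 4) 1 * |Real.log φ.1.1|)) ∂lam
      ≤ ENNReal.ofReal M := by
    refine le_trans (lintegral_mono fun φ => ENNReal.ofReal_le_ofReal ?_) hmom
    rw [Real.rpow_def_of_pos (frob_pos _), Real.exp_le_exp]
    have h1 := abs_log_fst_le φ
    have h2 := log_frob_nonneg (toP φ)
    have h3 : min (θ / 4) 1 ≤ θ / 4 := min_le_left _ _
    calc 2 * min (θ / 4) 1 * |Real.log φ.1.1|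
        ≤ 2 * (θ / 4) * (2 * Real.log (frob (toP φ))) := by gcongr
      _ = _ := by ring
  obtain ⟨c, ρ, hc, hcδ, hρ0, hρ1, hle⟩ := exists_quadratic_lt_one hδ (neg_pos.2 hcontr)
    (show 0 ≤ 2 / (min (θ / 4) 1) ^ 2 * M by positivity)
  refine ⟨c, ρ, hc, hcδ.trans (min_le_right _ _), ?_, hρ0, hρ1, ?_⟩
  · linarith [hcδ.trans (min_le_left _ _)]
  · have h := lintegral_exp_mul_le lam (AffP.measurable_fst.log) hδ (by positivity) hB
      (neg_neg _).symm.le hc.le hcδ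
    refine le_trans (le_of_eq (lintegral_congr fun φ => ?_))
      (h.trans (ENNReal.ofReal_le_ofReal hle))
    rw [Real.rpow_def_of_pos φ.2, mul_comm]

/-- A law on the affine group which contracts in `L^α` with rate `ρ`. -/
structure ContractsInMean (lam : Measure AffP) (α ρ M : ℝ) : Prop where
  exponent_pos : 0 < α
  exponent_le_one : α ≤ 1
  rate_pos : 0 < ρ
  rate_lt_one : ρ < 1
  const_nonneg : 0 ≤ M
  scale : ∫⁻ φ : AffP, ENNReal.ofReal (φ.1.1 ^ α) ∂lam ≤ ENNReal.ofReal ρ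
  shift : ∫⁻ φ : AffP, ENNReal.ofReal (|φ.1.2| ^ α) ∂lam ≤ ENNReal.ofReal M

theorem measure_ge_le_of_lintegral_le {Ω : Type*} [MeasurableSpace Ω] {μ : Measure Ω} {f : Ω → ℝ}
    (hf : Measurable f) {A a : ℝ} (ha : 0 < a)
    (hA : ∫⁻ ω, ENNReal.ofReal (f ω) ∂μ ≤ ENNReal.ofReal A) :
    μ {ω | a ≤ f ω} ≤ ENNReal.ofReal (A / a) := by
  rw [ENNReal.ofReal_div_of_pos ha]
  refine le_trans (measure_mono fun ω (hω : a ≤ f ω) => ENNReal.ofReal_le_ofReal hω)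
    ((meas_ge_le_lintegral_div hf.ennreal_ofReal.aemeasurable
      (ENNReal.ofReal_pos.2 ha).ne' ENNReal.ofReal_ne_top).trans ?_)
  gcongr

theorem measurable_fst_rpow (α : ℝ) : Measurable fun φ : AffP => φ.1.1 ^ α :=
  AffP.measurable_fst.pow_const α

theorem measurable_abs_snd_rpow (α : ℝ) : Measurable fun φ : AffP => |φ.1.2| ^ α :=
  (AffP.measurable_snd.norm).pow_const α

namespace ContractsInMean

variable {lam : Measure AffP} [IsProbabilityMeasure lam] {α ρ M : ℝ}

theorem lintegral_scale_le (h : ContractsInMean lam α ρ M) (n : ℕ) :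
    ∫⁻ φ : AffP, ENNReal.ofReal (φ.1.1 ^ α) ∂(affConv lam n) ≤ ENNReal.ofReal (ρ ^ n) := by
  have := lintegral_affConv_le_pow (measurable_fst_rpow α)
    (fun φ => Real.rpow_nonneg φ.2.le α)
    (fun φ ψ => (Real.mul_rpow φ.2.le ψ.2.le).le) h.rate_pos.le h.scale n
  simpa [AffP.one_fst] using this

theorem lintegral_shift_le (h : ContractsInMean lam α ρ M) (n : ℕ) :
    ∫⁻ φ : AffP, ENNReal.ofReal (|φ.1.2| ^ α) ∂(affConv lam n)
      ≤ ENNReal.ofReal (M / (1 - ρ)) := by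
  have hα := h.exponent_pos
  have hρ := h.rate_pos
  have hM := h.const_nonneg
  have hsum : ∫⁻ φ : AffP, ENNReal.ofReal (|φ.1.2| ^ α) ∂(affConv lam n)
      ≤ ENNReal.ofReal (M * ∑ i ∈ Finset.range n, ρ ^ i) := by
    induction n with
    | zero =>
      simp [affConv, lintegral_dirac' _ (measurable_abs_snd_rpow α).ennreal_ofReal,
        AffP.one_snd, Real.zero_rpow hα.ne']
    | succ n ih =>
      have m1 := (measurable_abs_snd_rpow α).ennreal_ofReal
      have m2 := (measurable_fst_rpow α).ennreal_ofReal
      rw [affConv, Measure.lintegral_mconv m1]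
      calc ∫⁻ x : AffP, ∫⁻ y : AffP, ENNReal.ofReal (|(x * y).1.2| ^ α) ∂(affConv lam n) ∂lam
          ≤ ∫⁻ x : AffP, ∫⁻ y : AffP, (ENNReal.ofReal (|x.1.2| ^ α) * ENNReal.ofReal (y.1.1 ^ α)
              + ENNReal.ofReal (|y.1.2| ^ α)) ∂(affConv lam n) ∂lam := by
            refine lintegral_mono fun x => lintegral_mono fun y => ?_
            have hy := y.2
            rw [← ENNReal.ofReal_mul (by positivity),
              ← ENNReal.ofReal_add (by positivity) (by positivity)]
            refine ENNReal.ofReal_le_ofReal ?_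
            rw [AffP.mul_snd, mul_comm (|x.1.2| ^ α), ← Real.mul_rpow hy.le (abs_nonneg _)]
            have e : y.1.1 * |x.1.2| = |y.1.1 * x.1.2| := by rw [abs_mul, abs_of_pos hy]
            rw [e]
            exact (Real.rpow_le_rpow (abs_nonneg _) (abs_add_le _ _) hα.le).trans
              (Real.rpow_add_le_add_rpow (abs_nonneg _) (abs_nonneg _) hα.le h.exponent_le_one)
        _ = (∫⁻ x : AffP, ENNReal.ofReal (|x.1.2| ^ α) ∂lam)
              * (∫⁻ y : AffP, ENNReal.ofReal (y.1.1 ^ α) ∂(affConv lam n))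
              + ∫⁻ y : AffP, ENNReal.ofReal (|y.1.2| ^ α) ∂(affConv lam n) := by
            simp_rw [lintegral_add_right _ m1, lintegral_const_mul _ m2]
            rw [lintegral_add_right _ measurable_const, lintegral_mul_const _ m1]
            simp
        _ ≤ ENNReal.ofReal M * ENNReal.ofReal (ρ ^ n)
              + ENNReal.ofReal (M * ∑ i ∈ Finset.range n, ρ ^ i) :=
            add_le_add (mul_le_mul' h.shift (h.lintegral_scale_le n)) ih
        _ = _ := by
            rw [← ENNReal.ofReal_mul hM, ← ENNReal.ofReal_add (by positivity) (by positivity),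
              Finset.sum_range_succ]
            ring_nf
  refine hsum.trans (ENNReal.ofReal_le_ofReal ?_)
  rw [div_eq_mul_inv]
  refine mul_le_mul_of_nonneg_left ?_ hM
  rw [← tsum_geometric_of_lt_one hρ.le h.rate_lt_one]
  exact (summable_geometric_of_lt_one hρ.le h.rate_lt_one).sum_le_tsum _
    fun i _ => by positivity

end ContractsInMean

/-- The mass given to `[t - ε, t + ε]` by the translation part after `n` steps. -/
noncomputable def ballMass (lam : Measure AffP) (n : ℕ) (t ε : ℝ) : ℝ≥0∞ :=
  affConv lam n {φ | |φ.1.2 - t| ≤ ε}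

theorem measurableSet_abs_snd_sub_le (t ε : ℝ) : MeasurableSet {φ : AffP | |φ.1.2 - t| ≤ ε} :=
  measurableSet_le ((AffP.measurable_snd.sub_const t).norm) measurable_const

theorem ballMass_mono (lam : Measure AffP) (n : ℕ) (t : ℝ) {ε ε' : ℝ} (h : ε ≤ ε') :
    ballMass lam n t ε ≤ ballMass lam n t ε' :=
  measure_mono fun _ hφ => le_trans hφ h

theorem ContractsInMean.ballMass_add_le {lam : Measure AffP} [IsProbabilityMeasure lam]
    {α ρ M : ℝ} (h : ContractsInMean lam α ρ M) (j n : ℕ) (t : ℝ) {ε : ℝ} (hε : 0 < ε) :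
    ballMass lam (j + n) t ε
      ≤ ballMass lam n t (2 * ε) + ENNReal.ofReal (M / (1 - ρ) * ρ ^ n / ε ^ α) := by
  have hα := h.exponent_pos
  have m1 := measurable_abs_snd_rpow α
  have m2 := measurable_fst_rpow α
  have hM1 : 0 ≤ M / (1 - ρ) := div_nonneg h.const_nonneg (sub_nonneg.2 h.rate_lt_one.le)
  have hprod : ∫⁻ p : AffP × AffP, ENNReal.ofReal (|p.1.1.2| ^ α * p.2.1.1 ^ α)
      ∂((affConv lam j).prod (affConv lam n)) ≤ ENNReal.ofReal (M / (1 - ρ) * ρ ^ n) := by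
    have e : ∀ p : AffP × AffP, ENNReal.ofReal (|p.1.1.2| ^ α * p.2.1.1 ^ α)
        = ENNReal.ofReal (|p.1.1.2| ^ α) * ENNReal.ofReal (p.2.1.1 ^ α) :=
      fun p => ENNReal.ofReal_mul (by positivity)
    simp_rw [e]
    rw [lintegral_prod_mul (f := fun x : AffP => ENNReal.ofReal (|x.1.2| ^ α))
      (g := fun y : AffP => ENNReal.ofReal (y.1.1 ^ α)) m1.ennreal_ofReal.aemeasurable
      m2.ennreal_ofReal.aemeasurable, ENNReal.ofReal_mul hM1]
    exact mul_le_mul' (h.lintegral_shift_le j) (h.lintegral_scale_le n)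
  have mp : Measurable fun p : AffP × AffP => |p.1.1.2| ^ α * p.2.1.1 ^ α :=
    (m1.comp measurable_fst).mul (m2.comp measurable_snd)
  have hmarkov := measure_ge_le_of_lintegral_le mp (Real.rpow_pos_of_pos hε α) hprod
  rw [ballMass, affConv_add, Measure.mconv,
    Measure.map_apply measurable_mul (measurableSet_abs_snd_sub_le t ε)]
  have hsub : (fun p : AffP × AffP => p.1 * p.2) ⁻¹' {φ | |φ.1.2 - t| ≤ ε}
      ⊆ (Set.univ ×ˢ {φ : AffP | |φ.1.2 - t| ≤ 2 * ε})
        ∪ {p : AffP × AffP | ε ^ α ≤ |p.1.1.2| ^ α * p.2.1.1 ^ α} := by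
    rintro ⟨x, y⟩ hxy
    have hxy' : |y.1.1 * x.1.2 + y.1.2 - t| ≤ ε := hxy
    by_cases hc : ε ≤ |x.1.2| * y.1.1
    · right
      change ε ^ α ≤ |x.1.2| ^ α * y.1.1 ^ α
      rw [← Real.mul_rpow (abs_nonneg _) y.2.le]
      exact Real.rpow_le_rpow hε.le hc hα.le
    · left
      refine ⟨Set.mem_univ _, ?_⟩
      push Not at hc
      have e : |y.1.1 * x.1.2| = |x.1.2| * y.1.1 := by rw [abs_mul, abs_of_pos y.2, mul_comm]
      rw [← e] at hc
      change |y.1.2 - t| ≤ 2 * ε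
      have := abs_sub (y.1.1 * x.1.2 + y.1.2 - t) (y.1.1 * x.1.2)
      rw [show y.1.2 - t = (y.1.1 * x.1.2 + y.1.2 - t) - y.1.1 * x.1.2 by ring]
      linarith
  refine (measure_mono hsub).trans ((measure_union_le _ _).trans (add_le_add ?_ hmarkov))
  rw [Measure.prod_prod, measure_univ, one_mul, ballMass]

theorem ballMass_succ (lam : Measure AffP) [IsProbabilityMeasure lam] (n : ℕ) (t ε : ℝ) :
    ballMass lam (n + 1) t ε
      = ∫⁻ ψ : AffP, ballMass lam n ((t - ψ.1.2) / ψ.1.1) (ε / ψ.1.1) ∂lam := by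
  rw [ballMass, affConv_add, affConv_one, Measure.mconv,
    Measure.map_apply measurable_mul (measurableSet_abs_snd_sub_le t ε),
    Measure.prod_apply_symm (measurable_mul (measurableSet_abs_snd_sub_le t ε))]
  refine lintegral_congr fun ψ => ?_
  rw [ballMass]
  congr 1
  ext φ
  change |ψ.1.1 * φ.1.2 + ψ.1.2 - t| ≤ ε ↔ |φ.1.2 - (t - ψ.1.2) / ψ.1.1| ≤ ε / ψ.1.1
  have hψ := ψ.2
  have e : ψ.1.1 * φ.1.2 + ψ.1.2 - t = ψ.1.1 * (φ.1.2 - (t - ψ.1.2) / ψ.1.1) := by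
    field_simp
    ring
  rw [e, abs_mul, abs_of_pos hψ, le_div_iff₀ hψ, mul_comm]

theorem measurable_ballMass_pullback (lam : Measure AffP) [IsProbabilityMeasure lam] (n : ℕ)
    (t ε : ℝ) :
    Measurable fun ψ : AffP => ballMass lam n ((t - ψ.1.2) / ψ.1.1) (ε / ψ.1.1) := by
  have hS : MeasurableSet
      {p : AffP × AffP | |p.2.1.2 - (t - p.1.1.2) / p.1.1.1| ≤ ε / p.1.1.1} := by
    have h1 : Measurable fun p : AffP × AffP => p.1.1.1 := AffP.measurable_fst.comp measurable_fst
    have h2 : Measurable fun p : AffP × AffP => p.1.1.2 := AffP.measurable_snd.comp measurable_fst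
    have h3 : Measurable fun p : AffP × AffP => p.2.1.2 := AffP.measurable_snd.comp measurable_snd
    exact measurableSet_le (h3.sub ((h2.const_sub t).div h1)).norm (h1.const_div ε)
  exact measurable_measure_prodMk_left hS

/-- The mass of the atom at `t` of the limiting distribution of the translation part. -/
noncomputable def atomMass (lam : Measure AffP) (t : ℝ) : ℝ≥0∞ :=
  ⨅ k : ℕ, limsup (fun n => ballMass lam n t (1 / (k + 1 : ℝ))) atTop

theorem atomMass_le_lintegral (lam : Measure AffP) [IsProbabilityMeasure lam] (t : ℝ) :
    atomMass lam t ≤ ∫⁻ ψ : AffP, atomMass lam ((t - ψ.1.2) / ψ.1.1) ∂lam := by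
  set G : ℕ → AffP → ℝ≥0∞ := fun k ψ =>
    limsup (fun n => ballMass lam n ((t - ψ.1.2) / ψ.1.1) (1 / (k + 1 : ℝ) / ψ.1.1)) atTop with hG
  have hle1 : ∀ n s ε, ballMass lam n s ε ≤ 1 := fun n s ε => prob_le_one
  have h1 : ∀ k : ℕ, limsup (fun n => ballMass lam n t (1 / (k + 1 : ℝ))) atTop
      ≤ ∫⁻ ψ, G k ψ ∂lam := by
    intro k
    rw [← limsup_nat_add _ 1]
    simp_rw [ballMass_succ]
    exact limsup_lintegral_le (fun _ => 1) (fun n => measurable_ballMass_pullback lam n t _)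
      (fun n => ae_of_all _ fun ψ => hle1 _ _ _) (by simp)
  have hGmeas : ∀ k, Measurable (G k) := fun k =>
    Measurable.limsup fun n => measurable_ballMass_pullback lam n t _
  have hGanti : Antitone G := by
    intro k l hkl ψ
    refine limsup_le_limsup (Eventually.of_forall fun n => ballMass_mono _ _ _ ?_)
    have hψ := ψ.2
    gcongr
  have hGfin : ∫⁻ ψ, G 0 ψ ∂lam ≠ ⊤ := by
    refine ne_of_lt (lt_of_le_of_lt (lintegral_mono (g := fun _ => 1) fun ψ => ?_) (by simp))
    exact limsup_le_of_le (h := Eventually.of_forall fun n => hle1 _ _ _)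
  calc atomMass lam t ≤ ⨅ k, ∫⁻ ψ, G k ψ ∂lam := iInf_mono h1
    _ = ∫⁻ ψ, ⨅ k, G k ψ ∂lam := (lintegral_iInf hGmeas hGanti hGfin).symm
    _ ≤ _ := by
      refine lintegral_mono fun ψ => le_iInf fun k => ?_
      have hψ := ψ.2
      obtain ⟨l, hl⟩ := exists_nat_gt ((k + 1 : ℝ) / ψ.1.1)
      refine (iInf_le _ l).trans
        (limsup_le_limsup (Eventually.of_forall fun n => ballMass_mono _ _ _ ?_))
      rw [div_div, one_div_le_one_div (by positivity) (by positivity)]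
      rw [div_lt_iff₀ hψ] at hl
      nlinarith

namespace ContractsInMean

variable {lam : Measure AffP} [IsProbabilityMeasure lam] {α ρ M : ℝ}

theorem atomMass_le (h : ContractsInMean lam α ρ M) (t : ℝ) (k n : ℕ) :
    atomMass lam t ≤ ballMass lam n t (2 * (1 / (k + 1 : ℝ)))
      + ENNReal.ofReal (M / (1 - ρ) * ρ ^ n / (1 / (k + 1 : ℝ)) ^ α) := by
  refine (iInf_le _ k).trans ?_
  rw [← limsup_nat_add _ n]
  exact limsup_le_of_le
    (h := Eventually.of_forall fun j => h.ballMass_add_le j n t (by positivity))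

theorem sum_atomMass_le_one (h : ContractsInMean lam α ρ M) (s : Finset ℝ) :
    ∑ t ∈ s, atomMass lam t ≤ 1 := by
  obtain ⟨k, hk⟩ : ∃ k : ℕ, ∀ t ∈ s, ∀ u ∈ s, t ≠ u → 4 * (1 / (k + 1 : ℝ)) < |t - u| := by
    have : ∀ᶠ k : ℕ in atTop, ∀ t ∈ s, ∀ u ∈ s, t ≠ u → 4 * (1 / (k + 1 : ℝ)) < |t - u| := by
      refine (eventually_all_finset s).2 fun t _ => (eventually_all_finset s).2 fun u _ => ?_
      by_cases htu : t = u
      · exact Eventually.of_forall fun k hk => absurd htu hk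
      · have h1 := (tendsto_one_div_add_atTop_nhds_zero_nat (𝕜 := ℝ)).const_mul 4
        rw [mul_zero] at h1
        exact (h1.eventually_lt_const (abs_pos.2 (sub_ne_zero.2 htu))).mono fun k hk _ => hk
    exact this.exists
  have hbound : ∀ n : ℕ, ∑ t ∈ s, atomMass lam t
      ≤ 1 + s.card * ENNReal.ofReal (M / (1 - ρ) * ρ ^ n / (1 / (k + 1 : ℝ)) ^ α) := by
    intro n
    refine (Finset.sum_le_sum fun t _ => h.atomMass_le t k n).trans ?_
    rw [Finset.sum_add_distrib, Finset.sum_const, nsmul_eq_mul]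
    refine add_le_add ?_ le_rfl
    simp only [ballMass]
    rw [← measure_biUnion_finset]
    · exact prob_le_one
    · intro t ht u hu htu
      refine Set.disjoint_left.2 fun φ h1 h2 => ?_
      have h3 := hk t ht u hu htu
      have h1' : |φ.1.2 - t| ≤ 2 * (1 / (k + 1 : ℝ)) := h1
      have h2' : |φ.1.2 - u| ≤ 2 * (1 / (k + 1 : ℝ)) := h2
      have h4 := abs_sub (φ.1.2 - u) (φ.1.2 - t)
      rw [show φ.1.2 - u - (φ.1.2 - t) = t - u by ring] at h4
      linarith
    · exact fun t _ => measurableSet_abs_snd_sub_le _ _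
  refine ge_of_tendsto' (x := atTop) ?_ hbound
  have h1 : Tendsto (fun n : ℕ => M / (1 - ρ) * ρ ^ n / (1 / (k + 1 : ℝ)) ^ α) atTop (𝓝 0) := by
    have := ((tendsto_pow_atTop_nhds_zero_of_lt_one h.rate_pos.le h.rate_lt_one).const_mul
      (M / (1 - ρ))).div_const ((1 / (k + 1 : ℝ)) ^ α)
    simpa using this
  have h2 := ENNReal.tendsto_ofReal h1
  rw [ENNReal.ofReal_zero] at h2
  have h3 := (ENNReal.Tendsto.const_mul h2
    (Or.inr (ENNReal.natCast_ne_top s.card))).const_add 1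
  simpa using h3

/-- Without a common fixed point, the limiting distribution of the translation part has no atom. -/
theorem atomMass_eq_zero (h : ContractsInMean lam α ρ M)
    (hnofix : ¬ ∃ t : ℝ, ∀ φ ∈ msupport lam, φ.1.1 * t + φ.1.2 = t) (t : ℝ) :
    atomMass lam t = 0 := by
  by_contra ht
  have hsum : ∑' t, atomMass lam t ≠ ⊤ := by
    rw [ENNReal.tsum_eq_iSup_sum]
    exact ne_of_lt (lt_of_le_of_lt (iSup_le h.sum_atomMass_le_one) ENNReal.one_lt_top)
  have hfin : {s | atomMass lam t ≤ atomMass lam s}.Finite :=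
    ENNReal.finite_const_le_of_tsum_ne_top hsum ht
  obtain ⟨t₁, ht₁, hmax⟩ := Set.exists_max_image _ (atomMass lam) hfin ⟨t, le_refl (atomMass lam t)⟩
  have hmax' : ∀ s, atomMass lam s ≤ atomMass lam t₁ := by
    intro s
    rcases le_total (atomMass lam t) (atomMass lam s) with hs | hs
    · exact hmax s hs
    · exact hs.trans ht₁
  set m := atomMass lam t₁ with hm
  have hm0 : m ≠ 0 := fun h0 => ht (le_antisymm (h0 ▸ hmax' t) bot_le)
  have hmtop : m ≠ ⊤ := by
    have := h.sum_atomMass_le_one {t₁}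
    rw [Finset.sum_singleton] at this
    exact ne_of_lt (lt_of_le_of_lt this ENNReal.one_lt_top)
  set Z : Set ℝ := {s | atomMass lam s = m} with hZ
  have hZfin : Z.Finite := hfin.subset fun s (hs : _ = _) => by
    change _ ≤ atomMass lam s
    rw [hs]
    exact ht₁
  obtain ⟨z₀, hz₀, hmin⟩ := Set.exists_min_image Z id hZfin ⟨t₁, rfl⟩
  have hae : ∀ z ∈ Z, ∀ᵐ ψ : AffP ∂lam, (z - ψ.1.2) / ψ.1.1 ∈ Z := by
    intro z hz
    have hle := atomMass_le_lintegral lam z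
    rw [show atomMass lam z = m from hz] at hle
    have hub : ∫⁻ ψ : AffP, atomMass lam ((z - ψ.1.2) / ψ.1.1) ∂lam ≤ m :=
      (lintegral_mono (g := fun _ => m) fun ψ => hmax' _).trans (by simp)
    exact ae_eq_of_ae_le_of_lintegral_le (g := fun _ => m) (ae_of_all _ fun ψ => hmax' _)
      (ne_top_of_le_ne_top hmtop hub) aemeasurable_const (by simpa using hle)
  have hclosed : IsClosed {ψ : AffP | ∀ z ∈ Z, (z - ψ.1.2) / ψ.1.1 ∈ Z} := by
    simp only [Set.ofPred_forall]
    refine isClosed_biInter fun z _ => hZfin.isClosed.preimage ?_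
    exact (continuous_const.sub continuous_subtype_val.snd).div continuous_subtype_val.fst
      fun ψ => ψ.2.ne'
  have hfull : ∀ᵐ ψ : AffP ∂lam, ∀ z ∈ Z, (z - ψ.1.2) / ψ.1.1 ∈ Z :=
    (ae_ball_iff hZfin.countable).2 hae
  refine hnofix ⟨z₀, fun φ hφ => ?_⟩
  have hinv : ∀ z ∈ Z, (z - φ.1.2) / φ.1.1 ∈ Z := by
    by_contra hcon
    exact (hφ _ hclosed.isOpen_compl hcon).ne' (mem_ae_iff.1 hfull)
  have hφ0 := φ.2
  obtain ⟨z, hz, hzz⟩ := Set.surj_on_of_inj_on_of_ncard_le (fun z _ => (z - φ.1.2) / φ.1.1) hinv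
    (fun x y _ _ hxy => by simpa [div_left_inj' hφ0.ne'] using hxy) le_rfl hZfin z₀ hz₀
  have h1 : z₀ ≤ z := hmin z hz
  have h2 : z₀ ≤ (z₀ - φ.1.2) / φ.1.1 := hmin _ (hinv z₀ hz₀)
  have h3 : (z₀ - φ.1.2) / φ.1.1 ≤ z₀ := by
    nth_rewrite 2 [hzz]
    gcongr
  have h4 : (z₀ - φ.1.2) / φ.1.1 = z₀ := le_antisymm h3 h2
  rw [div_eq_iff hφ0.ne'] at h4
  linarith

end ContractsInMean

theorem continuous_enorm2 : Continuous enorm2 := by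
  unfold enorm2
  fun_prop

theorem isCompact_enorm2_eq_one : IsCompact {v : Fin 2 → ℝ | enorm2 v = 1} := by
  refine (isCompact_Icc (a := fun _ : Fin 2 => (-1 : ℝ)) (b := fun _ => 1)).of_isClosed_subset
    (isClosed_eq continuous_enorm2 continuous_const) fun v (hv : enorm2 v = 1) => ?_
  have hb : ∀ i, |v i| ≤ 1 := fun i => hv ▸ abs_apply_le_enorm2 v i
  exact ⟨fun i => (abs_le.1 (hb i)).1, fun i => (abs_le.1 (hb i)).2⟩

namespace ContractsInMean

variable {lam : Measure AffP} [IsProbabilityMeasure lam] {α ρ M : ℝ}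

theorem exists_measure_abs_snd_ge_le (h : ContractsInMean lam α ρ M) {p : ℝ} (hp : 0 < p) :
    ∃ R : ℝ, 0 < R ∧ ∀ n, affConv lam n {φ | R ≤ |φ.1.2|} ≤ ENNReal.ofReal p := by
  have hα := h.exponent_pos
  have hM : 0 ≤ M / (1 - ρ) := div_nonneg h.const_nonneg (sub_nonneg.2 h.rate_lt_one.le)
  set a : ℝ := M / (1 - ρ) / p + 1 with ha
  have ha0 : 0 < a := by positivity
  refine ⟨a ^ α⁻¹, by positivity, fun n => ?_⟩
  have hsub : {φ : AffP | a ^ α⁻¹ ≤ |φ.1.2|} ⊆ {φ | a ≤ |φ.1.2| ^ α} := by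
    intro φ hφ
    have := Real.rpow_le_rpow (by positivity) (show a ^ α⁻¹ ≤ |φ.1.2| from hφ) hα.le
    rwa [← Real.rpow_mul ha0.le, inv_mul_cancel₀ hα.ne', Real.rpow_one] at this
  refine (measure_mono hsub).trans ((measure_ge_le_of_lintegral_le
    (measurable_abs_snd_rpow α) ha0 (h.lintegral_shift_le n)).trans
    (ENNReal.ofReal_le_ofReal ?_))
  rw [div_le_iff₀ ha0, ha, mul_add, mul_div_cancel₀ _ hp.ne']
  linarith

/-- The image of a fixed vector rarely comes close to the contracted direction. -/
theorem exists_measure_abs_add_le (h : ContractsInMean lam α ρ M)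
    (hnofix : ¬ ∃ t : ℝ, ∀ φ ∈ msupport lam, φ.1.1 * t + φ.1.2 = t)
    {p : ℝ} (hp : 0 < p) {v : Fin 2 → ℝ} (hv : enorm2 v = 1) :
    ∃ ε : ℝ, 0 < ε ∧ ε ≤ 1 ∧ ∃ n₀, ∀ n, n₀ ≤ n →
      affConv lam n {φ | |v 0 + φ.1.2 * v 1| ≤ ε} ≤ ENNReal.ofReal p := by
  by_cases hv1 : v 1 = 0
  · have hv0 : |v 0| = 1 := by
      rw [enorm2, hv1] at hv
      simpa [Real.sqrt_sq_eq_abs] using hv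
    refine ⟨1 / 2, by norm_num, by norm_num, 0, fun n _ => ?_⟩
    have : {φ : AffP | |v 0 + φ.1.2 * v 1| ≤ 1 / 2} = ∅ := by
      ext φ
      simp only [hv1, mul_zero, add_zero, hv0]
      norm_num
    rw [this, measure_empty]
    exact bot_le
  · have h0 := h.atomMass_eq_zero hnofix (-v 0 / v 1)
    have hpos : (0 : ℝ≥0∞) < ENNReal.ofReal p := ENNReal.ofReal_pos.2 hp
    rw [atomMass] at h0
    rw [← h0] at hpos
    obtain ⟨k, hk⟩ := iInf_lt_iff.1 hpos
    obtain ⟨n₀, hn₀⟩ := eventually_atTop.1 (eventually_lt_of_limsup_lt hk)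
    have hv1' : 0 < |v 1| := abs_pos.2 hv1
    refine ⟨min 1 (|v 1| * (1 / (k + 1 : ℝ))), by positivity, min_le_left _ _, n₀,
      fun n hn => le_trans (measure_mono fun φ hφ => ?_) (hn₀ n hn).le⟩
    have hφ' : |v 0 + φ.1.2 * v 1| ≤ |v 1| * (1 / (k + 1 : ℝ)) := le_trans hφ (min_le_right _ _)
    rw [show v 0 + φ.1.2 * v 1 = v 1 * (φ.1.2 - -v 0 / v 1) by field_simp; ring, abs_mul] at hφ'
    exact le_of_mul_le_mul_left hφ' hv1'

/-- The bound of `exists_measure_abs_add_le` holds uniformly over all directions. -/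
theorem exists_uniform_measure_abs_add_le (h : ContractsInMean lam α ρ M)
    (hnofix : ¬ ∃ t : ℝ, ∀ φ ∈ msupport lam, φ.1.1 * t + φ.1.2 = t) {p : ℝ} (hp : 0 < p) :
    ∃ ε : ℝ, 0 < ε ∧ ε ≤ 1 ∧ ∃ n₀, ∀ n, n₀ ≤ n → ∀ v : Fin 2 → ℝ, enorm2 v = 1 →
      affConv lam n {φ | |v 0 + φ.1.2 * v 1| ≤ ε} ≤ ENNReal.ofReal p := by
  obtain ⟨R, hR, hRn⟩ := h.exists_measure_abs_snd_ge_le (half_pos hp)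
  have key := isCompact_enorm2_eq_one.induction_on
    (p := fun S => ∃ ε : ℝ, 0 < ε ∧ ε ≤ 1 ∧ ∃ n₀, ∀ n, n₀ ≤ n → ∀ v ∈ S,
      affConv lam n {φ | |v 0 + φ.1.2 * v 1| ≤ ε} ≤ ENNReal.ofReal p)
    ⟨1, one_pos, le_rfl, 0, fun n _ v hv => absurd hv (Set.notMem_empty v)⟩
    (fun S T hST ⟨ε, hε, hε1, n₀, H⟩ => ⟨ε, hε, hε1, n₀, fun n hn v hv => H n hn v (hST hv)⟩)
    ?_ ?_
  · exact key
  · rintro S T ⟨ε, hε, hε1, n₀, H⟩ ⟨ε', hε', -, n₀', H'⟩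
    refine ⟨min ε ε', lt_min hε hε', (min_le_left _ _).trans hε1, max n₀ n₀', fun n hn v hv => ?_⟩
    rcases hv with hv | hv
    · refine le_trans (measure_mono fun φ hφ => ?_) (H n (le_of_max_le_left hn) v hv)
      exact (show |v 0 + φ.1.2 * v 1| ≤ min ε ε' from hφ).trans (min_le_left _ _)
    · refine le_trans (measure_mono fun φ hφ => ?_) (H' n (le_of_max_le_right hn) v hv)
      exact (show |v 0 + φ.1.2 * v 1| ≤ min ε ε' from hφ).trans (min_le_right _ _)
  · intro v hv
    obtain ⟨ε, hε, hε1, n₀, H⟩ := h.exists_measure_abs_add_le hnofix (half_pos hp) hv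
    refine ⟨Metric.ball v (ε / 2 / (1 + R)), mem_nhdsWithin_of_mem_nhds
      (Metric.ball_mem_nhds v (by positivity)), ε / 2, half_pos hε, by linarith, n₀,
      fun n hn w hw => ?_⟩
    have hw' : dist w v * (1 + R) < ε / 2 := by
      rwa [Metric.mem_ball, lt_div_iff₀ (by positivity)] at hw
    have hwi : ∀ i, |v i - w i| ≤ dist w v := fun i => by
      rw [dist_comm]
      exact dist_le_pi_dist v w i
    have hsub : {φ : AffP | |w 0 + φ.1.2 * w 1| ≤ ε / 2}
        ⊆ {φ | |v 0 + φ.1.2 * v 1| ≤ ε} ∪ {φ | R ≤ |φ.1.2|} := by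
      intro φ (hφ : |w 0 + φ.1.2 * w 1| ≤ ε / 2)
      by_cases hb : R ≤ |φ.1.2|
      · exact Or.inr hb
      · left
        change |v 0 + φ.1.2 * v 1| ≤ ε
        have h1 : |φ.1.2 * (v 1 - w 1)| ≤ R * dist w v := by
          rw [abs_mul]
          exact mul_le_mul (not_le.1 hb).le (hwi 1) (abs_nonneg _) hR.le
        have h2 := abs_add_three (w 0 + φ.1.2 * w 1) (v 0 - w 0) (φ.1.2 * (v 1 - w 1))
        rw [show w 0 + φ.1.2 * w 1 + (v 0 - w 0) + φ.1.2 * (v 1 - w 1)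
          = v 0 + φ.1.2 * v 1 by ring] at h2
        have h3 := hwi 0
        linarith
    calc _ ≤ _ := measure_mono hsub
      _ ≤ ENNReal.ofReal (p / 2) + ENNReal.ofReal (p / 2) :=
        (measure_union_le _ _).trans (add_le_add (H n hn) (hRn n))
      _ = ENNReal.ofReal p := by
        rw [← ENNReal.ofReal_add (half_pos hp).le (half_pos hp).le, add_halves]

end ContractsInMean

theorem lintegral_frob_rpow_le {lam : Measure AffP} [IsProbabilityMeasure lam] {θ M : ℝ}
    (hθ : 0 ≤ θ) (hM : 0 ≤ M)
    (hmom : ∫⁻ φ, ENNReal.ofReal (frob (toP φ) ^ θ) ∂lam ≤ ENNReal.ofReal M) (n : ℕ) :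
    ∫⁻ φ, ENNReal.ofReal (frob (toP φ) ^ θ) ∂(affConv lam n)
      ≤ ENNReal.ofReal (M ^ n * frob 1 ^ θ) := by
  rw [← toP_one]
  refine lintegral_affConv_le_pow (measurable_frob_toP.pow_const θ)
    (fun φ => Real.rpow_nonneg (frob_pos _).le θ) (fun φ ψ => ?_) hM hmom n
  rw [toP_mul, ← Real.mul_rpow (frob_pos _).le (frob_pos _).le]
  exact Real.rpow_le_rpow (frob_pos _).le (frob_mul_le _ _) hθ

/-- The standing assumptions give contraction in some `L^α`. -/
theorem exists_contractsInMean {lam : Measure AffP} [IsProbabilityMeasure lam] {θ M : ℝ}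
    (hθ : 0 < θ) (hM : 1 ≤ M)
    (hmom : ∫⁻ φ, ENNReal.ofReal (frob (toP φ) ^ θ) ∂lam ≤ ENNReal.ofReal M)
    (hcontr : ∫ φ : AffP, Real.log φ.1.1 ∂lam < 0) :
    ∃ α ρ : ℝ, ContractsInMean lam α ρ M := by
  obtain ⟨α, ρ, hα, hα1, hαθ, hρ, hρ1, hle⟩ := exists_contraction_exponent hθ hM hmom hcontr
  refine ⟨α, ρ, hα, hα1, hρ, hρ1, zero_le_one.trans hM, hle, le_trans (lintegral_mono fun φ =>
    ENNReal.ofReal_le_ofReal ?_) hmom⟩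
  calc |φ.1.2| ^ α ≤ (frob (toP φ) ^ 2) ^ α :=
        Real.rpow_le_rpow (abs_nonneg _) (abs_snd_le_sq_frob φ) hα.le
    _ = frob (toP φ) ^ (2 * α) := by
        rw [← Real.rpow_natCast, ← Real.rpow_mul (frob_pos _).le]
        norm_num
    _ ≤ _ := Real.rpow_le_rpow_of_exponent_le (one_le_frob _) hαθ

/-- Minus the logarithmic growth of the vector `v` under `toP φ`. -/
noncomputable def logDecay (v : Fin 2 → ℝ) (φ : AffP) : ℝ :=
  -Real.log (enorm2 ((toP φ).1.mulVec v))

theorem measurable_logDecay (v : Fin 2 → ℝ) : Measurable (logDecay v) := by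
  unfold logDecay enorm2
  simp_rw [toP_mulVec_zero, toP_mulVec_one]
  have h1 := AffP.measurable_fst
  have h2 := AffP.measurable_snd
  fun_prop

theorem abs_logDecay_le {v : Fin 2 → ℝ} (hv : enorm2 v = 1) (φ : AffP) :
    |logDecay v φ| ≤ Real.log (frob (toP φ)) := by
  have h1 := enorm2_mulVec_le (toP φ) v
  have h2 := enorm2_le_frob_mul (toP φ) v
  rw [hv] at h1 h2
  rw [mul_one] at h1
  have h3 : 0 < enorm2 ((toP φ).1.mulVec v) := by
    by_contra! h
    nlinarith [frob_pos (toP φ)]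
  rw [logDecay, abs_neg, abs_le]
  refine ⟨?_, Real.log_le_log h3 h1⟩
  have := Real.log_le_log one_pos h2
  rw [Real.log_one, Real.log_mul (frob_pos _).ne' h3.ne'] at this
  linarith

theorem logDecay_le_of_lt_abs {v : Fin 2 → ℝ} {φ : AffP} {ε : ℝ} (hε : 0 < ε)
    (h : ε < |v 0 + φ.1.2 * v 1|) :
    logDecay v φ ≤ Real.log φ.1.1 / 2 - Real.log ε := by
  have h1 := abs_apply_le_enorm2 ((toP φ).1.mulVec v) 0
  have hr := Real.sqrt_pos.2 φ.2
  rw [toP_mulVec_zero, abs_mul, abs_of_pos (inv_pos.2 hr)] at h1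
  have h2 : (Real.sqrt φ.1.1)⁻¹ * ε ≤ enorm2 ((toP φ).1.mulVec v) :=
    le_trans (by gcongr) h1
  have h3 := Real.log_le_log (by positivity) h2
  rw [Real.log_mul (by positivity) hε.ne', Real.log_inv, Real.log_sqrt φ.2.le] at h3
  rw [logDecay]
  linarith

theorem mul_log_le {a x s : ℝ} (hx : 0 < x) (hs : 0 < s) (n : ℕ) :
    a * Real.log x ≤ n * Real.log s + x ^ a * (s ^ n)⁻¹ := by
  have h1 : 0 < x ^ a * (s ^ n)⁻¹ := by positivity
  have h2 := Real.log_le_sub_one_of_pos h1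
  rw [Real.log_mul (by positivity) (by positivity), Real.log_inv, Real.log_pow,
    Real.log_rpow hx] at h2
  linarith

theorem integrable_logDecay {lam : Measure AffP} [IsProbabilityMeasure lam] {θ M : ℝ}
    (hθ : 0 < θ) (hM : 0 ≤ M)
    (hmom : ∫⁻ φ, ENNReal.ofReal (frob (toP φ) ^ θ) ∂lam ≤ ENNReal.ofReal M)
    {v : Fin 2 → ℝ} (hv : enorm2 v = 1) (n : ℕ) : Integrable (logDecay v) (affConv lam n) := by
  have hi := integrable_of_lintegral_ofReal_le (measurable_frob_toP.pow_const θ)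
    (fun φ => Real.rpow_nonneg (frob_pos _).le θ) (lintegral_frob_rpow_le hθ.le hM hmom n)
  refine (hi.const_mul θ⁻¹).mono' (measurable_logDecay v).aestronglyMeasurable
    (ae_of_all _ fun φ => ?_)
  refine (abs_logDecay_le hv φ).trans ?_
  have := mul_log_le (a := θ) (frob_pos (toP φ)) one_pos 0
  rw [inv_mul_eq_div, le_div_iff₀ hθ]
  simpa [mul_comm] using this

namespace ContractsInMean

variable {lam : Measure AffP} [IsProbabilityMeasure lam] {α ρ M : ℝ}

theorem integral_logDecay_le (h : ContractsInMean lam α ρ M) {θ : ℝ} (hθ : 0 < θ) (hM : 1 ≤ M)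
    (hmom : ∫⁻ φ, ENNReal.ofReal (frob (toP φ) ^ θ) ∂lam ≤ ENNReal.ofReal M)
    {v : Fin 2 → ℝ} (hv : enorm2 v = 1) {ε p : ℝ} (hε : 0 < ε) (hε1 : ε ≤ 1) (hp : 0 ≤ p) {n : ℕ}
    (hbad : affConv lam n {φ | |v 0 + φ.1.2 * v 1| ≤ ε} ≤ ENNReal.ofReal p) :
    ∫ φ, logDecay v φ ∂(affConv lam n)
      ≤ (n * Real.log ρ + 1) / (2 * α) - Real.log ε
        + 2 / θ * (p * (n * Real.log M) + frob 1 ^ θ) := by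
  have hα := h.exponent_pos
  have hρ := h.rate_pos
  have hM0 : 0 < M := one_pos.trans_le hM
  set bad : Set AffP := {φ | |v 0 + φ.1.2 * v 1| ≤ ε} with hbad_def
  have mbad : MeasurableSet bad :=
    measurableSet_le ((AffP.measurable_snd.mul_const _).const_add _).norm measurable_const
  have hs0 : ∀ φ : AffP, 0 ≤ φ.1.1 ^ α := fun φ => Real.rpow_nonneg φ.2.le α
  have hf0 : ∀ φ : AffP, 0 ≤ frob (toP φ) ^ θ := fun φ => Real.rpow_nonneg (frob_pos _).le θ
  have hw : 0 ≤ frob 1 ^ θ := Real.rpow_nonneg (frob_pos _).le θ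
  have hfr := lintegral_frob_rpow_le hθ.le hM0.le hmom n
  have i1 := integrable_of_lintegral_ofReal_le (measurable_fst_rpow α) hs0 (h.lintegral_scale_le n)
  have i2 := integrable_of_lintegral_ofReal_le (measurable_frob_toP.pow_const θ) hf0 hfr
  have b1 := integral_le_of_lintegral_ofReal_le (measurable_fst_rpow α) hs0 (by positivity)
    (h.lintegral_scale_le n)
  have b2 := integral_le_of_lintegral_ofReal_le (measurable_frob_toP.pow_const θ) hf0
    (by positivity) hfr
  have i3 : Integrable (bad.indicator fun _ => n * Real.log M) (affConv lam n) :=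
    (integrable_const _).indicator mbad
  have b3 : ∫ φ, bad.indicator (fun _ => n * Real.log M) φ ∂(affConv lam n)
      ≤ p * (n * Real.log M) := by
    rw [integral_indicator_const _ mbad, smul_eq_mul]
    have := Real.log_nonneg hM
    gcongr
    exact ENNReal.toReal_le_of_le_ofReal hp hbad
  have hpt : ∀ φ, logDecay v φ ≤ (n * Real.log ρ + φ.1.1 ^ α * (ρ ^ n)⁻¹) / (2 * α) - Real.log ε
      + 2 / θ * (bad.indicator (fun _ => n * Real.log M) φ + frob (toP φ) ^ θ * (M ^ n)⁻¹) := by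
    intro φ
    have h1 := mul_log_le (a := α) φ.2 hρ n
    have h2 := mul_log_le (a := θ) (frob_pos (toP φ)) hM0 n
    have h3 : Real.log φ.1.1 / 2 ≤ (n * Real.log ρ + φ.1.1 ^ α * (ρ ^ n)⁻¹) / (2 * α) := by
      rw [div_le_div_iff₀ two_pos (by positivity)]
      linarith
    have h4 := Real.log_nonpos hε.le hε1
    by_cases hφ : φ ∈ bad
    · rw [Set.indicator_of_mem hφ]
      have h5 : 2 * Real.log (frob (toP φ))
          ≤ 2 / θ * (n * Real.log M + frob (toP φ) ^ θ * (M ^ n)⁻¹) := by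
        rw [div_mul_eq_mul_div, le_div_iff₀ hθ]
        linarith
      have h6 := (abs_le.1 (abs_log_fst_le φ)).1
      have h7 := (abs_le.1 (abs_logDecay_le hv φ)).2
      linarith
    · rw [Set.indicator_of_notMem hφ]
      have h5 := logDecay_le_of_lt_abs hε (not_le.1 hφ)
      have h6 : 0 ≤ 2 / θ * (0 + frob (toP φ) ^ θ * (M ^ n)⁻¹) := by
        have := hf0 φ
        positivity
      linarith
  have j1 : Integrable (fun φ : AffP => n * Real.log ρ + φ.1.1 ^ α * (ρ ^ n)⁻¹) (affConv lam n) :=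
    (integrable_const _).add (i1.mul_const _)
  have j2 : Integrable (fun φ : AffP => bad.indicator (fun _ => n * Real.log M) φ
      + frob (toP φ) ^ θ * (M ^ n)⁻¹) (affConv lam n) := i3.add (i2.mul_const _)
  have j3 : Integrable (fun φ : AffP => (n * Real.log ρ + φ.1.1 ^ α * (ρ ^ n)⁻¹) / (2 * α)
      - Real.log ε) (affConv lam n) := (j1.div_const _).sub (integrable_const _)
  refine (integral_mono (integrable_logDecay hθ hM0.le hmom hv n)
    (j3.add (j2.const_mul _)) hpt).trans ?_
  simp only [Pi.add_apply]
  rw [integral_add j3 (j2.const_mul _), integral_sub (j1.div_const _) (integrable_const _),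
    integral_const_mul, integral_div, integral_add (integrable_const _) (i1.mul_const _),
    integral_add i3 (i2.mul_const _), integral_mul_const (ρ ^ n)⁻¹,
    integral_mul_const (M ^ n)⁻¹]
  simp only [integral_const, probReal_univ, smul_eq_mul, one_mul]
  rw [← div_eq_mul_inv, ← div_eq_mul_inv]
  have c1 : (∫ φ : AffP, φ.1.1 ^ α ∂(affConv lam n)) / ρ ^ n ≤ 1 := by
    rw [div_le_one (by positivity)]
    exact b1
  have c2 : (∫ φ : AffP, frob (toP φ) ^ θ ∂(affConv lam n)) / M ^ n ≤ frob 1 ^ θ := by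
    rw [div_le_iff₀ (by positivity), mul_comm]
    exact b2
  gcongr

/-- After sufficiently many steps, every vector grows on average. -/
theorem exists_integral_logDecay_le (h : ContractsInMean lam α ρ M) {θ : ℝ} (hθ : 0 < θ)
    (hM : 1 ≤ M) (hmom : ∫⁻ φ, ENNReal.ofReal (frob (toP φ) ^ θ) ∂lam ≤ ENNReal.ofReal M)
    (hnofix : ¬ ∃ t : ℝ, ∀ φ ∈ msupport lam, φ.1.1 * t + φ.1.2 = t) :
    ∃ n, 0 < n ∧ ∀ v : Fin 2 → ℝ, enorm2 v = 1 → ∫ φ, logDecay v φ ∂(affConv lam n) ≤ -1 := by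
  have hα := h.exponent_pos
  have hl : 0 < -Real.log ρ := neg_pos.2 (Real.log_neg h.rate_pos h.rate_lt_one)
  have hlM := Real.log_nonneg hM
  set p : ℝ := -Real.log ρ * θ / (8 * α * (Real.log M + 1)) with hp_def
  have hp : 0 < p := by positivity
  obtain ⟨ε, hε, hε1, n₀, H⟩ := h.exists_uniform_measure_abs_add_le hnofix hp
  set K : ℝ := 1 / (2 * α) - Real.log ε + 2 / θ * frob 1 ^ θ with hK
  obtain ⟨m, hm⟩ := exists_nat_ge ((K + 1) * (4 * α) / -Real.log ρ)
  refine ⟨max (n₀ + 1) m, lt_max_of_lt_left n₀.succ_pos, fun v hv => ?_⟩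
  set n := max (n₀ + 1) m with hn
  have hnm : (m : ℝ) ≤ n := Nat.cast_le.2 (le_max_right _ _)
  refine (h.integral_logDecay_le hθ hM hmom hv hε hε1 hp.le
    (H n ((Nat.le_succ _).trans (le_max_left _ _)) v hv)).trans ?_
  have h1 := hm.trans hnm
  rw [div_le_iff₀ hl] at h1
  have h2 : 2 / θ * (p * (n * Real.log M)) ≤ n * (-Real.log ρ) / (4 * α) := by
    have e : 2 / θ * (p * (n * Real.log M))
        = n * (-Real.log ρ) / (4 * α) * (Real.log M / (Real.log M + 1)) := by
      rw [hp_def]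
      field_simp
      ring
    rw [e]
    refine mul_le_of_le_one_right (by positivity) ?_
    rw [div_le_one (by positivity)]
    linarith
  have h3 : K + 1 ≤ n * (-Real.log ρ) / (4 * α) := by
    rw [le_div_iff₀ (by positivity)]
    exact h1
  have e : (n * Real.log ρ + 1) / (2 * α)
      = 1 / (2 * α) - 2 * (n * (-Real.log ρ) / (4 * α)) := by
    field_simp
    ring
  rw [e, mul_add]
  linarith

end ContractsInMean

/-- Some convolution power of the law contracts a negative power of the norm, uniformly over all
vectors. -/
theorem exists_lintegral_enorm2_rpow_neg_le {lam : Measure AffP} [IsProbabilityMeasure lam]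
    {θ M : ℝ} (hθ : 0 < θ) (hM : 1 ≤ M)
    (hmom : ∫⁻ φ, ENNReal.ofReal (frob (toP φ) ^ θ) ∂lam ≤ ENNReal.ofReal M)
    (hnofix : ¬ ∃ t : ℝ, ∀ φ ∈ msupport lam, φ.1.1 * t + φ.1.2 = t)
    (hcontr : ∫ φ : AffP, Real.log φ.1.1 ∂lam < 0) :
    ∃ (c κ : ℝ) (n : ℕ), 0 < c ∧ c ≤ θ ∧ 0 < κ ∧ κ < 1 ∧ 0 < n ∧ ∀ v : Fin 2 → ℝ, v ≠ 0 →
      ∫⁻ φ, ENNReal.ofReal (enorm2 ((toP φ).1.mulVec v) ^ (-c)) ∂(affConv lam n)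
        ≤ ENNReal.ofReal (κ * enorm2 v ^ (-c)) := by
  obtain ⟨α, ρ, h⟩ := exists_contractsInMean hθ hM hmom hcontr
  obtain ⟨n, hn, H⟩ := h.exists_integral_logDecay_le hθ hM hmom hnofix
  have hM0 : 0 < M := one_pos.trans_le hM
  have hB : 0 ≤ M ^ n * frob 1 ^ θ :=
    mul_nonneg (by positivity) (Real.rpow_nonneg (frob_pos _).le θ)
  obtain ⟨c, κ, hc, hcθ, hκ, hκ1, hle⟩ := exists_quadratic_lt_one (half_pos hθ) one_pos
    (show 0 ≤ 2 / (θ / 2) ^ 2 * (M ^ n * frob 1 ^ θ) by positivity)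
  have hunit : ∀ v : Fin 2 → ℝ, enorm2 v = 1 →
      ∫⁻ φ, ENNReal.ofReal (enorm2 ((toP φ).1.mulVec v) ^ (-c)) ∂(affConv lam n)
        ≤ ENNReal.ofReal κ := by
    intro v hv
    have hv0 : v ≠ 0 := by
      rintro rfl
      simp [enorm2] at hv
    refine le_trans (le_of_eq (lintegral_congr fun φ => ?_)) ((lintegral_exp_mul_le (affConv lam n)
      (measurable_logDecay v) (half_pos hθ) hB (le_trans (lintegral_mono fun φ =>
        ENNReal.ofReal_le_ofReal ?_) (lintegral_frob_rpow_le hθ.le hM0.le hmom n)) (H v hv) hc.le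
      hcθ).trans (ENNReal.ofReal_le_ofReal hle))
    · rw [Real.rpow_def_of_pos (enorm2_pos (mulVec_ne_zero_SL2 _ hv0)), logDecay]
      ring_nf
    · rw [Real.rpow_def_of_pos (frob_pos _), Real.exp_le_exp]
      have := mul_le_mul_of_nonneg_left (abs_logDecay_le hv φ) hθ.le
      linarith
  refine ⟨c, κ, n, hc, by linarith, hκ, hκ1, hn, fun v hv => ?_⟩
  have hpos := enorm2_pos hv
  have hu := hunit ((enorm2 v)⁻¹ • v) (by
    rw [enorm2_smul, abs_of_pos (inv_pos.2 hpos), inv_mul_cancel₀ hpos.ne'])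
  have e : ∀ φ : AffP, ENNReal.ofReal (enorm2 ((toP φ).1.mulVec v) ^ (-c))
      = ENNReal.ofReal (enorm2 v ^ (-c))
        * ENNReal.ofReal (enorm2 ((toP φ).1.mulVec ((enorm2 v)⁻¹ • v)) ^ (-c)) := by
    intro φ
    rw [← ENNReal.ofReal_mul (Real.rpow_nonneg hpos.le _),
      ← Real.mul_rpow hpos.le (enorm2_nonneg _), Matrix.mulVec_smul, enorm2_smul,
      abs_of_pos (inv_pos.2 hpos), mul_inv_cancel_left₀ hpos.ne']
  simp_rw [e]
  rw [lintegral_const_mul' _ _ ENNReal.ofReal_ne_top, mul_comm κ,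
    ENNReal.ofReal_mul (Real.rpow_nonneg hpos.le _)]
  exact mul_le_mul_right hu _

/-- The expected value of `sys ^ (-c)` after `n` steps. -/
noncomputable def sysMoment (lam : Measure AffP) (c : ℝ) (n : ℕ) (g : SL2) : ℝ≥0∞ :=
  ∫⁻ φ, ENNReal.ofReal (sys (toP φ * g) ^ (-c)) ∂(affConv lam n)

theorem lintegral_frob_rpow_le_of_le {μ : Measure AffP} {c θ A : ℝ} (hcθ : c ≤ θ)
    (h : ∫⁻ φ, ENNReal.ofReal (frob (toP φ) ^ θ) ∂μ ≤ ENNReal.ofReal A) :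
    ∫⁻ φ, ENNReal.ofReal (frob (toP φ) ^ c) ∂μ ≤ ENNReal.ofReal A :=
  (lintegral_mono fun _ => ENNReal.ofReal_le_ofReal
    (Real.rpow_le_rpow_of_exponent_le (one_le_frob _) hcθ)).trans h

theorem sysMoment_le_mul {lam : Measure AffP} {c A : ℝ} (hc : 0 < c) {n : ℕ}
    (h : ∫⁻ φ, ENNReal.ofReal (frob (toP φ) ^ c) ∂(affConv lam n) ≤ ENNReal.ofReal A) (g : SL2) :
    sysMoment lam c n g ≤ ENNReal.ofReal A * ENNReal.ofReal (sys g ^ (-c)) := by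
  have hpt : ∀ φ : AffP, ENNReal.ofReal (sys (toP φ * g) ^ (-c))
      ≤ ENNReal.ofReal (frob (toP φ) ^ c) * ENNReal.ofReal (sys g ^ (-c)) := by
    intro φ
    have hf := frob_pos (toP φ)
    have hs := sys_pos (toP φ * g)
    rw [← ENNReal.ofReal_mul (Real.rpow_nonneg hf.le c)]
    refine ENNReal.ofReal_le_ofReal ?_
    have h1 := Real.rpow_le_rpow_of_nonpos (sys_pos g) (sys_le_frob_mul_sys (toP φ) g)
      (neg_nonpos.2 hc.le)
    rw [Real.mul_rpow hf.le hs.le, Real.rpow_neg hf.le, inv_mul_le_iff₀ (by positivity)] at h1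
    exact h1
  refine (lintegral_mono hpt).trans ?_
  rw [lintegral_mul_const' _ _ ENNReal.ofReal_ne_top]
  gcongr

theorem sysMoment_le_add {lam : Measure AffP} {c κ A : ℝ} (hc : 0 < c) (hκ : 0 ≤ κ) {n : ℕ}
    (hfrob : ∫⁻ φ, ENNReal.ofReal (frob (toP φ) ^ c) ∂(affConv lam n) ≤ ENNReal.ofReal A)
    (hcontr : ∀ v : Fin 2 → ℝ, v ≠ 0 →
      ∫⁻ φ, ENNReal.ofReal (enorm2 ((toP φ).1.mulVec v) ^ (-c)) ∂(affConv lam n)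
        ≤ ENNReal.ofReal (κ * enorm2 v ^ (-c))) (g : SL2) :
    sysMoment lam c n g
      ≤ ENNReal.ofReal κ * ENNReal.ofReal (sys g ^ (-c)) + ENNReal.ofReal A := by
  obtain ⟨u, hu, hsys, hmin⟩ := exists_min_le_sys_mul g
  have hpt : ∀ φ : AffP, ENNReal.ofReal (sys (toP φ * g) ^ (-c))
      ≤ ENNReal.ofReal (enorm2 ((toP φ).1.mulVec u) ^ (-c))
        + ENNReal.ofReal (frob (toP φ) ^ c) := by
    intro φ
    have hf := frob_pos (toP φ)
    have he := enorm2_pos (mulVec_ne_zero_SL2 (toP φ) hu)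
    have h1 : 0 ≤ enorm2 ((toP φ).1.mulVec u) ^ (-c) := by positivity
    have h2 : 0 ≤ frob (toP φ) ^ c := by positivity
    rw [← ENNReal.ofReal_add h1 h2]
    refine ENNReal.ofReal_le_ofReal ((Real.rpow_le_rpow_of_nonpos (by positivity) (hmin (toP φ))
      (neg_nonpos.2 hc.le)).trans ?_)
    rcases min_choice (enorm2 ((toP φ).1.mulVec u)) (frob (toP φ))⁻¹ with h | h
    · rw [h]
      linarith
    · rw [h, Real.inv_rpow hf.le, Real.rpow_neg hf.le, inv_inv]
      linarith
  refine (lintegral_mono hpt).trans ?_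
  rw [lintegral_add_right _ (measurable_frob_toP.pow_const c).ennreal_ofReal,
    ← ENNReal.ofReal_mul hκ, ← hsys]
  exact add_le_add (hcontr u hu) hfrob

theorem sysMoment_add_le {lam : Measure AffP} [IsProbabilityMeasure lam] {c : ℝ} {n : ℕ}
    {a b : ℝ≥0∞} (ha : a ≠ ⊤)
    (h : ∀ g, sysMoment lam c n g ≤ a * ENNReal.ofReal (sys g ^ (-c)) + b) (m : ℕ) (g : SL2) :
    sysMoment lam c (n + m) g ≤ a * sysMoment lam c m g + b := by
  rw [sysMoment, affConv_add]
  refine (lintegral_mconv_le_swap _ _ _).trans ?_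
  calc ∫⁻ y, ∫⁻ x, ENNReal.ofReal (sys (toP (x * y) * g) ^ (-c)) ∂(affConv lam n) ∂(affConv lam m)
      = ∫⁻ y, sysMoment lam c n (toP y * g) ∂(affConv lam m) := by
        simp_rw [toP_mul, mul_assoc]
        rfl
    _ ≤ ∫⁻ y, (a * ENNReal.ofReal (sys (toP y * g) ^ (-c)) + b) ∂(affConv lam m) :=
        lintegral_mono fun y => h _
    _ = a * sysMoment lam c m g + b := by
        rw [lintegral_add_right _ measurable_const, lintegral_const_mul' _ _ ha]
        simp [sysMoment]

/-- Iteration of the drift inequality. -/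
theorem sysMoment_mul_add_le {lam : Measure AffP} [IsProbabilityMeasure lam] {c κ A : ℝ} {n : ℕ}
    (hκ : 0 ≤ κ) (hκ1 : κ < 1) (hA : 0 ≤ A)
    (h : ∀ g, sysMoment lam c n g
      ≤ ENNReal.ofReal κ * ENNReal.ofReal (sys g ^ (-c)) + ENNReal.ofReal A) {r : ℕ} {g : SL2}
    (hr : sysMoment lam c r g ≤ ENNReal.ofReal A * ENNReal.ofReal (sys g ^ (-c))) (q : ℕ) :
    sysMoment lam c (n * q + r) g
      ≤ ENNReal.ofReal (κ ^ q * (A * sys g ^ (-c)) + A / (1 - κ)) := by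
  have hs : 0 ≤ sys g ^ (-c) := Real.rpow_nonneg (sys_pos g).le _
  have h1κ : 0 < 1 - κ := sub_pos.2 hκ1
  induction q with
  | zero =>
    rw [mul_zero, zero_add]
    refine hr.trans ?_
    rw [← ENNReal.ofReal_mul hA]
    refine ENNReal.ofReal_le_ofReal ?_
    have : 0 ≤ A / (1 - κ) := by positivity
    linarith
  | succ q ih =>
    rw [show n * (q + 1) + r = n + (n * q + r) by ring]
    refine (sysMoment_add_le ENNReal.ofReal_ne_top h _ g).trans
      ((add_le_add (mul_le_mul_right ih _) le_rfl).trans ?_)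
    rw [← ENNReal.ofReal_mul hκ, ← ENNReal.ofReal_add (by positivity) hA]
    refine ENNReal.ofReal_le_ofReal (le_of_eq ?_)
    field_simp
    ring

/-- Effective recurrence: `∫ sys(hg)^{-c} dμ^{*n}(h) ≤ C (e^{-c'n} sys(g)^{-c} + 1)`. -/
theorem effective_recurrence
    (lam : Measure AffP) [IsProbabilityMeasure lam]
    (hmom : ∃ ε : ℝ, 0 < ε ∧
      ∫⁻ φ : AffP, ENNReal.ofReal (φ.1.1 ^ ε + φ.1.1 ^ (-ε) + |φ.1.2| ^ ε) ∂lam < ⊤)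
    (hnofix : ¬ ∃ t : ℝ, ∀ φ ∈ msupport lam, φ.1.1 * t + φ.1.2 = t)
    (hcontr : ∫ φ : AffP, Real.log φ.1.1 ∂lam < 0) :
    ∃ c c' C : ℝ, 0 < c ∧ 0 < c' ∧ 0 < C ∧
      ∀ g : SL2, ∀ n : ℕ,
        ∫⁻ h, ENNReal.ofReal (sys (h * g) ^ (-c)) ∂(convN (Measure.map toP lam) n) ≤
          ENNReal.ofReal (C * (Real.exp (-c' * n) * sys g ^ (-c) + 1)) := by
  obtain ⟨θ, M, hθ, hM, hmomθ⟩ := exists_moment_frob hmom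
  obtain ⟨c, κ, N, hc, hcθ, hκ, hκ1, hN, H⟩ :=
    exists_lintegral_enorm2_rpow_neg_le hθ hM hmomθ hnofix hcontr
  have hM0 : 0 < M := one_pos.trans_le hM
  have hN0 : (0 : ℝ) < N := Nat.cast_pos.2 hN
  have hw : 0 < frob 1 ^ θ := Real.rpow_pos_of_pos (frob_pos _) θ
  set A : ℝ := M ^ N * frob 1 ^ θ with hA_def
  have hA : 0 < A := by positivity
  have hfrob : ∀ r ≤ N,
      ∫⁻ φ, ENNReal.ofReal (frob (toP φ) ^ c) ∂(affConv lam r) ≤ ENNReal.ofReal A := by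
    intro r hr
    refine lintegral_frob_rpow_le_of_le hcθ ((lintegral_frob_rpow_le hθ.le hM0.le hmomθ r).trans
      (ENNReal.ofReal_le_ofReal ?_))
    rw [hA_def]
    gcongr
  have hl : 0 < -Real.log κ := neg_pos.2 (Real.log_neg hκ hκ1)
  have h1κ : 0 < 1 - κ := sub_pos.2 hκ1
  refine ⟨c, -Real.log κ / N, A / κ + A / (1 - κ), hc, by positivity, by positivity,
    fun g n => ?_⟩
  rw [convN_map_toP]
  refine (lintegral_map_le _ _).trans ?_
  have hiter := sysMoment_mul_add_le hκ.le hκ1 hA.le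
    (sysMoment_le_add hc hκ.le (hfrob N le_rfl) H)
    (sysMoment_le_mul hc (hfrob (n % N) (Nat.mod_lt n hN).le) g) (n / N)
  rw [Nat.div_add_mod] at hiter
  refine hiter.trans (ENNReal.ofReal_le_ofReal ?_)
  have hpow : κ ^ (n / N) ≤ κ⁻¹ * Real.exp (-(-Real.log κ / N) * n) := by
    have hn : (n : ℝ) ≤ N * ((n / N : ℕ) + 1) := by
      exact_mod_cast (Nat.lt_mul_div_succ n hN).le
    rw [← Real.exp_log hκ, ← Real.exp_nat_mul, ← Real.exp_neg, ← Real.exp_add, Real.exp_le_exp,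
      Real.log_exp]
    have h1 : (n : ℝ) / N ≤ (n / N : ℕ) + 1 := by
      rw [div_le_iff₀ hN0]
      linarith
    have h2 : -(-Real.log κ / N) * n = -(-Real.log κ * (n / N)) := by ring
    have h3 := mul_le_mul_of_nonneg_left h1 hl.le
    rw [h2]
    linarith
  have hs : 0 ≤ sys g ^ (-c) := Real.rpow_nonneg (sys_pos g).le _
  set E : ℝ := Real.exp (-(-Real.log κ / N) * n) with hE
  have hE0 : 0 < E := Real.exp_pos _
  calc κ ^ (n / N) * (A * sys g ^ (-c)) + A / (1 - κ)
      ≤ κ⁻¹ * E * (A * sys g ^ (-c)) + A / (1 - κ) := by gcongr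
    _ = A / κ * (E * sys g ^ (-c)) + A / (1 - κ) * 1 := by ring
    _ ≤ (A / κ + A / (1 - κ)) * (E * sys g ^ (-c)) + (A / κ + A / (1 - κ)) * 1 := by
        have h1 : 0 ≤ A / κ := by positivity
        have h2 : 0 ≤ A / (1 - κ) := by positivity
        gcongr <;> linarith
    _ = _ := by ring
end

section
/- Let (a, b, c) ∈ ℝ³ and ε ∈ (0,1) with max(|a|, |b|) ≥ ε, and let ρ ∈ (0,1). Then the set E := {s ∈ [−ρ^{−1/4}, ρ^{−1/4}] : |a s² + b s + c| ≤ ρ} is contained in the union of at most two closed intervals of radius 8 ε^{−1} ρ^{1/4}, i.e. there exist s₁, s₂ ∈ ℝ with E ⊆ [s₁ − 8ε^{−1}ρ^{1/4}, s₁ + 8ε^{−1}ρ^{1/4}] ∪ [s₂ − 8ε^{−1}ρ^{1/4}, s₂ + 8ε^{−1}ρ^{1/4}]. -/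
open Set

/-- If the linear coefficient dominates, two points where a quadratic polynomial is small are
close to each other. -/
theorem abs_sub_le_of_abs_quadratic_le {a b c ε ρ s t : ℝ} (hε : 0 < ε) (hb : ε ≤ |b|)
    (hst : |a * (s + t)| ≤ ε / 2) (hs : |a * s ^ 2 + b * s + c| ≤ ρ)
    (ht : |a * t ^ 2 + b * t + c| ≤ ρ) : |s - t| ≤ 4 * ε⁻¹ * ρ := by
  have hprod : |s - t| * |b + a * (s + t)| ≤ 2 * ρ := by
    rw [← abs_mul, show (s - t) * (b + a * (s + t)) =
      (a * s ^ 2 + b * s + c) - (a * t ^ 2 + b * t + c) by ring]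
    linarith [abs_sub (a * s ^ 2 + b * s + c) (a * t ^ 2 + b * t + c)]
  have hlow : ε / 2 ≤ |b + a * (s + t)| := by
    linarith [abs_sub_abs_le_abs_add b (a * (s + t))]
  have hmul : |s - t| * (ε / 2) ≤ 2 * ρ :=
    (mul_le_mul_of_nonneg_left hlow (abs_nonneg _)).trans hprod
  rw [show 4 * ε⁻¹ * ρ = 4 * ρ / ε by ring, le_div_iff₀ hε]
  linarith

/-- If `u` is nonnegative and `u ^ 2` is within `h` of `d`, then `u` is within `√h` of `√d`
(also for negative `d`, where `√d = 0`). -/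
theorem sub_sqrt_sq_le {u d h : ℝ} (hu : 0 ≤ u) (hd : |u ^ 2 - d| ≤ h) : (u - √d) ^ 2 ≤ h := by
  obtain ⟨h1, h2⟩ := abs_le.mp hd
  rcases le_total 0 d with h0 | h0
  · have hw := Real.sq_sqrt h0
    have hw0 := Real.sqrt_nonneg d
    rcases le_total u (√d) with hle | hle <;> nlinarith
  · rw [Real.sqrt_eq_zero_of_nonpos h0]
    nlinarith

/-- A quadratic polynomial with leading coefficient `a` has two centres such that every point
where its absolute value is at most `ρ` lies within `√(ρ / |a|)` of one of them. -/
theorem exists_near_of_abs_quadratic_le {a : ℝ} (b c : ℝ) (ha : a ≠ 0) :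
    ∃ s₁ s₂ : ℝ, ∀ s ρ : ℝ, |a * s ^ 2 + b * s + c| ≤ ρ →
      (s - s₁) ^ 2 ≤ ρ / |a| ∨ (s - s₂) ^ 2 ≤ ρ / |a| := by
  set m := -b / (2 * a) with hm
  set d := m ^ 2 - c / a with hd
  refine ⟨m + √d, m - √d, fun s ρ hs => ?_⟩
  have hsq : |(s - m) ^ 2 - d| ≤ ρ / |a| := by
    have hsquare : ((s - m) ^ 2 - d) * a = a * s ^ 2 + b * s + c := by
      rw [hd, hm]
      field_simp
      ring
    rwa [le_div_iff₀ (abs_pos.mpr ha), ← abs_mul, hsquare]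
  rcases le_total 0 (s - m) with h0 | h0
  · left
    convert sub_sqrt_sq_le h0 hsq using 1
    ring
  · right
    rw [← neg_sq] at hsq
    convert sub_sqrt_sq_le (neg_nonneg.mpr h0) hsq using 1
    ring

/-- Sublevel sets of a quadratic polynomial: if `max(|a|,|b|) ≥ ε`, the set of
`s ∈ [−ρ^{−1/4}, ρ^{−1/4}]` with `|a s² + b s + c| ≤ ρ` is contained in at most two
closed intervals of radius `8 ε⁻¹ ρ^{1/4}`. -/
theorem quadratic_sublevel_two_intervals
    (a b c ε ρ : ℝ) (hε0 : 0 < ε) (hε1 : ε < 1) (hab : ε ≤ max |a| |b|)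
    (hρ0 : 0 < ρ) (hρ1 : ρ < 1) :
    ∃ s₁ s₂ : ℝ,
      {s : ℝ | s ∈ Icc (-(ρ ^ (-(1:ℝ)/4))) (ρ ^ (-(1:ℝ)/4)) ∧ |a * s ^ 2 + b * s + c| ≤ ρ} ⊆
        Icc (s₁ - 8 * ε⁻¹ * ρ ^ ((1:ℝ)/4)) (s₁ + 8 * ε⁻¹ * ρ ^ ((1:ℝ)/4)) ∪
        Icc (s₂ - 8 * ε⁻¹ * ρ ^ ((1:ℝ)/4)) (s₂ + 8 * ε⁻¹ * ρ ^ ((1:ℝ)/4)) := by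
  set r : ℝ := ρ ^ ((1:ℝ)/4) with hr
  have hr0 : 0 < r := Real.rpow_pos_of_pos hρ0 _
  have hr1 : r < 1 := Real.rpow_lt_one hρ0.le hρ1 (by norm_num)
  have hr4 : ρ = r ^ 4 := by
    rw [hr, ← Real.rpow_natCast, ← Real.rpow_mul hρ0.le]
    norm_num
  have hrinv : ρ ^ (-(1:ℝ)/4) = r⁻¹ := by
    rw [hr, ← Real.rpow_neg hρ0.le, neg_div]
  rw [hrinv]
  rcases le_or_gt |a| (ε * r / 4) with ha | ha
  · have hb : ε ≤ |b| := (le_max_iff.mp hab).resolve_left (by nlinarith)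
    by_cases hE : ∃ t, t ∈ Icc (-r⁻¹) r⁻¹ ∧ |a * t ^ 2 + b * t + c| ≤ ρ
    · obtain ⟨t, ht, htρ⟩ := hE
      refine ⟨t, t, fun s ⟨hs, hsρ⟩ => Or.inl ?_⟩
      have hst : |a * (s + t)| ≤ ε / 2 := by
        have hsum : |s + t| ≤ 2 * r⁻¹ :=
          abs_le.mpr ⟨by linarith [hs.1, ht.1], by linarith [hs.2, ht.2]⟩
        calc |a * (s + t)| = |a| * |s + t| := abs_mul _ _
          _ ≤ (ε * r / 4) * (2 * r⁻¹) := by gcongr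
          _ = ε / 2 := by field_simp; ring
      have hdist := abs_sub_le_of_abs_quadratic_le hε0 hb hst hsρ htρ
      have hpow : ρ ≤ r := hr4 ▸ pow_le_of_le_one hr0.le hr1.le (by norm_num)
      have hle : |s - t| ≤ 8 * ε⁻¹ * r := hdist.trans (by gcongr; norm_num)
      have := abs_le.mp hle
      constructor <;> linarith [this.1, this.2]
    · exact ⟨0, 0, fun s hs => (hE ⟨s, hs⟩).elim⟩
  · have ha0 : 0 < |a| := lt_trans (by positivity) ha
    obtain ⟨s₁, s₂, h⟩ := exists_near_of_abs_quadratic_le b c (abs_pos.mp ha0)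
    refine ⟨s₁, s₂, fun s ⟨_, hs⟩ => ?_⟩
    have hbound : ρ / |a| ≤ (8 * ε⁻¹ * r) ^ 2 := by
      rw [div_le_iff₀ ha0, hr4]
      have h1 : r ^ 4 ≤ r ^ 3 := pow_le_pow_of_le_one hr0.le hr1.le (by norm_num)
      have hεinv : 1 ≤ ε⁻¹ := (one_le_inv₀ hε0).mpr hε1.le
      calc r ^ 4 ≤ 1 * r ^ 3 := by simpa using h1
        _ ≤ (16 * ε⁻¹) * r ^ 3 := by gcongr; linarith
        _ = (8 * ε⁻¹ * r) ^ 2 * (ε * r / 4) := by field_simp; ring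
        _ ≤ (8 * ε⁻¹ * r) ^ 2 * |a| := by gcongr
    have hD : 0 ≤ 8 * ε⁻¹ * r := by positivity
    refine (h s ρ hs).imp (fun h' => ?_) (fun h' => ?_) <;>
    · have := abs_le_of_sq_le_sq' (h'.trans hbound) hD
      constructor <;> linarith [this.1, this.2]
end
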